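/- arXiv:1907.13253 — 2 statements merged into one kernel-verified Lean document; each statement's English description precedes it below -/
import Mathlib

section
/- Let ζ = ψ∘λ, K = {X ∈ Sⁿ : ζ(X) ≤ 0} satisfying Slater's condition, (X̄,Z̄) ∈ gph N_K and V̄ ∈ 𝕆ⁿ(X̄) ∩ 𝕆ⁿ(Z̄), and let v̄1 > … > v̄r be the distinct eigenvalues of X̄. Then for every H ∈ C(X̄+Z̄; N_K(X̄)), the support function of the second-order tangent set T²_K(X̄,H) := {W ∈ Sⁿ : ζ''(X̄;H,W) ≤ 0} evaluated at Z̄ equals δ*_{T²_K(X̄,H)}(Z̄) = 2 ∑_{l=1}^{r} ⟨ Λ(Z̄)_{α^l α^l}, V̄ᵀ_{α^l} H (X̄ − v̄_l I)† H V̄_{α^l} ⟩, where † denotes the Moore–Penrose pseudo-inverse and Λ(Z̄) = Diag(λ(Z̄)). -/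
open Matrix Filter Topology Set
open scoped Classical

noncomputable section

/-- The vector of eigenvalues of a symmetric matrix, in non-increasing order. -/
noncomputable def lamVec {n : ℕ} (X : Matrix (Fin n) (Fin n) ℝ) : Fin n → ℝ :=
  if h : X.IsHermitian then fun i => (h.eigenvalues ∘ Tuple.sort h.eigenvalues) i.rev else 0

/-- The set `𝕆ⁿ(X)` of orthogonal matrices giving an ordered eigenvalue decomposition of `X`. -/
def OSet {n : ℕ} (X : Matrix (Fin n) (Fin n) ℝ) : Set (Matrix (Fin n) (Fin n) ℝ) :=
  {U | Uᵀ * U = 1 ∧ X = U * Matrix.diagonal (lamVec X) * Uᵀ}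

/-- One-sided directional derivative of a scalar function. -/
noncomputable def dirDeriv {E : Type*} [AddCommMonoid E] [Module ℝ E] (f : E → ℝ) (x h : E) : ℝ :=
  limUnder (𝓝[>] (0:ℝ)) fun t => (f (x + t • h) - f x) / t

/-- Vector of one-sided directional derivatives of the ordered eigenvalues: `λ'(X;H)`. -/
noncomputable def lamDD {n : ℕ} (X H : Matrix (Fin n) (Fin n) ℝ) : Fin n → ℝ :=
  fun i => dirDeriv (fun Y => lamVec Y i) X H

/-- The max-of-affine convex piecewise affine function `φ(x) = max_i (⟨aⁱ,x⟩ - cᵢ)`. -/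
noncomputable def pwa {n p : ℕ} [NeZero p] (a : Fin p → Fin n → ℝ) (c : Fin p → ℝ)
    (x : Fin n → ℝ) : ℝ :=
  ⨆ i, (a i ⬝ᵥ x - c i)

/-- The active index set `ι(x̄)` of a max-of-affine function at `x̄`. -/
def iotaA {n p : ℕ} [NeZero p] (a : Fin p → Fin n → ℝ) (c : Fin p → ℝ)
    (x : Fin n → ℝ) : Set (Fin p) :=
  {i | a i ⬝ᵥ x - c i = pwa a c x}

/-- Frobenius inner product of two matrices. -/
def mip {n : ℕ} (A B : Matrix (Fin n) (Fin n) ℝ) : ℝ := (Aᵀ * B).trace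

/-- Convex subdifferential (over the space of symmetric matrices) of a real function. -/
def msubdiff {n : ℕ} (f : Matrix (Fin n) (Fin n) ℝ → ℝ) (X : Matrix (Fin n) (Fin n) ℝ) :
    Set (Matrix (Fin n) (Fin n) ℝ) :=
  {G | G.IsSymm ∧ ∀ Y : Matrix (Fin n) (Fin n) ℝ, Y.IsSymm → f X + mip G (Y - X) ≤ f Y}

/-- Moore–Penrose pseudo-inverse, via the four Penrose conditions. -/
noncomputable def mpInv {n : ℕ} (A : Matrix (Fin n) (Fin n) ℝ) : Matrix (Fin n) (Fin n) ℝ :=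
  Classical.epsilon fun B => A * B * A = A ∧ B * A * B = B ∧ (A * B)ᵀ = A * B ∧ (B * A)ᵀ = B * A

/-- The sigma-term function
`Υ_X(Y,H) = 2 ∑_l ⟨Λ(Y)_{αˡαˡ}, Uᵀ_{αˡ} H (X - v̄ₗ I)† H U_{αˡ}⟩` (written as a single sum
over eigenvalue indices). -/
noncomputable def Upsilon {n : ℕ} (X Y U H : Matrix (Fin n) (Fin n) ℝ) : ℝ :=
  2 * ∑ i, lamVec Y i *
    ((Uᵀ * H * mpInv (X - lamVec X i • (1 : Matrix (Fin n) (Fin n) ℝ)) * H * U) i i)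

/-- The active index set `ι₂(x̄) = {i : ⟨bⁱ,x̄⟩ = dᵢ}`. -/
def iotaC {n q : ℕ} (b : Fin q → Fin n → ℝ) (d : Fin q → ℝ) (x : Fin n → ℝ) : Set (Fin q) :=
  {i | b i ⬝ᵥ x = d i}

/-- The index set `η₂(x̄,z̄)`: active indices carrying a strictly positive weight in some
conic-combination representation of `z̄` by the active `bⁱ`'s. -/
def etaC {n q : ℕ} (b : Fin q → Fin n → ℝ) (d : Fin q → ℝ)
    (x z : Fin n → ℝ) : Set (Fin q) :=
  {i | ∃ u : Fin q → ℝ, (∀ j, 0 ≤ u j) ∧ (∀ j, j ∉ iotaC b d x → u j = 0) ∧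
        z = ∑ j, u j • b j ∧ 0 < u i}

/-- The normal cone (within `Sⁿ`) of a set of symmetric matrices. -/
def NK {n : ℕ} (K : Set (Matrix (Fin n) (Fin n) ℝ)) (X : Matrix (Fin n) (Fin n) ℝ) :
    Set (Matrix (Fin n) (Fin n) ℝ) :=
  {Z | Z.IsSymm ∧ ∀ Y ∈ K, mip Z (Y - X) ≤ 0}

/-- `i` and `j` belong to the same block `αˡ` of `X̄`. -/
def sameA {n : ℕ} (X : Matrix (Fin n) (Fin n) ℝ) (i j : Fin n) : Prop :=
  lamVec X i = lamVec X j

/-- `i` and `j` belong to the same sub-block `γˡₖ` (determined by the eigenvalues of both `X̄`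
and `Z̄`). -/
def sameG {n : ℕ} (X Z : Matrix (Fin n) (Fin n) ℝ) (i j : Fin n) : Prop :=
  lamVec X i = lamVec X j ∧ lamVec Z i = lamVec Z j

/-- The sub-block `γˡₖ` containing `i` is a "bad" block, i.e. `k ∈ Fₗ`: some `b^w`,
`w ∈ η₂(λ(X̄),λ(Z̄))`, is non-constant on it. -/
def badG {n q : ℕ} (b : Fin q → Fin n → ℝ) (d : Fin q → ℝ)
    (X Z : Matrix (Fin n) (Fin n) ℝ) (i : Fin n) : Prop :=
  ∃ z z' : Fin n, sameG X Z z i ∧ sameG X Z z' i ∧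
    ∃ w ∈ etaC b d (lamVec X) (lamVec Z), b w z ≠ b w z'

/-- Second-order (parabolic) directional derivative of a scalar function. -/
noncomputable def dirDeriv2 {E : Type*} [AddCommMonoid E] [Module ℝ E]
    (f : E → ℝ) (x h w : E) : ℝ :=
  limUnder (𝓝[>] (0:ℝ)) fun t =>
    (f (x + t • h + (t^2/2) • w) - f x - t * dirDeriv f x h) / (t^2/2)

namespace Sol

variable {n q : ℕ} [NeZero q]

lemma le_pwa (b : Fin q → Fin n → ℝ) (d : Fin q → ℝ) (x : Fin n → ℝ) (i : Fin q) :
    b i ⬝ᵥ x - d i ≤ pwa b d x :=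
  le_ciSup (f := fun i => b i ⬝ᵥ x - d i) (Set.finite_range _).bddAbove i

lemma pwa_le (b : Fin q → Fin n → ℝ) (d : Fin q → ℝ) (x : Fin n → ℝ) (c : ℝ)
    (h : ∀ i, b i ⬝ᵥ x - d i ≤ c) : pwa b d x ≤ c := by
  have : Nonempty (Fin q) := ⟨0⟩
  exact ciSup_le h

lemma schur (b : Fin q → Fin n → ℝ) (d : Fin q → ℝ)
    (hsym : ∀ (σ : Equiv.Perm (Fin n)) (x : Fin n → ℝ), pwa b d (x ∘ σ) = pwa b d x)
    (O : Matrix (Fin n) (Fin n) ℝ) (hO : Oᵀ * O = 1) (y : Fin n → ℝ) :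
    pwa b d (Oᵀ * diagonal y * O).diag ≤ pwa b d y := by
  have hO' : O * Oᵀ = 1 := mul_eq_one_comm.mp hO
  set S : Matrix (Fin n) (Fin n) ℝ := Matrix.of fun i k => O k i ^ 2 with hS
  have hSd : S ∈ doublyStochastic ℝ (Fin n) := by
    rw [mem_doublyStochastic_iff_sum]
    refine ⟨fun i j => sq_nonneg _, fun i => ?_, fun j => ?_⟩
    · have := congrFun (congrFun hO i) i
      simp only [mul_apply, transpose_apply, one_apply_eq] at this
      simpa [hS, sq] using this
    · have := congrFun (congrFun hO' j) j
      simp only [mul_apply, transpose_apply, one_apply_eq] at this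
      simpa [hS, sq] using this
  obtain ⟨w, hw0, hw1, hw⟩ := exists_eq_sum_perm_of_mem_doublyStochastic hSd
  have hdiag : (Oᵀ * diagonal y * O).diag = ∑ σ, w σ • (y ∘ σ) := by
    have h1 : (Oᵀ * diagonal y * O).diag = S *ᵥ y := by
      ext i
      rw [diag_apply, mul_apply]
      simp only [mul_diagonal, transpose_apply, mulVec, dotProduct, hS, of_apply]
      exact Finset.sum_congr rfl fun k _ => by ring
    rw [h1, ← hw, Matrix.sum_mulVec]
    refine Finset.sum_congr rfl fun σ _ => ?_
    ext i
    simp [smul_mulVec, Equiv.Perm.permMatrix, PEquiv.toMatrix_toPEquiv_mulVec]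
  rw [hdiag]
  refine pwa_le _ _ _ _ fun i => ?_
  have : b i ⬝ᵥ (∑ σ, w σ • (y ∘ σ)) - d i = ∑ σ, w σ * (b i ⬝ᵥ (y ∘ σ) - d i) := by
    simp only [mul_sub, Finset.sum_sub_distrib, ← Finset.sum_mul, hw1, one_mul, dotProduct_sum,
      dotProduct_smul, smul_eq_mul]
  rw [this]
  calc _ ≤ ∑ σ, w σ * pwa b d y := by
        refine Finset.sum_le_sum fun σ _ => mul_le_mul_of_nonneg_left ?_ (hw0 σ)
        rw [← hsym σ y]; exact le_pwa _ _ _ _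
    _ = _ := by rw [← Finset.sum_mul, hw1, one_mul]

lemma exists_OSet (X : Matrix (Fin n) (Fin n) ℝ) (hX : X.IsSymm) : ∃ U, U ∈ OSet X := by
  have h : X.IsHermitian := by
    rw [Matrix.IsHermitian, conjTranspose_eq_transpose_of_trivial]; exact hX
  let e : Fin n ≃ Fin n := Fin.revPerm.trans (Tuple.sort h.eigenvalues)
  let P : Matrix (Fin n) (Fin n) ℝ := h.eigenvectorUnitary
  have hP : Pᵀ * P = 1 := by
    have := Unitary.coe_star_mul_self h.eigenvectorUnitary
    rwa [star_eq_conjTranspose, conjTranspose_eq_transpose_of_trivial] at this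
  have hs : X = P * diagonal h.eigenvalues * Pᵀ := by
    have := h.spectral_theorem
    rwa [Unitary.conjStarAlgAut_apply, star_eq_conjTranspose,
      conjTranspose_eq_transpose_of_trivial] at this
  have hl : lamVec X = h.eigenvalues ∘ e := by
    ext i; rw [lamVec, dif_pos h]; rfl
  refine ⟨P.submatrix id e, ?_, ?_⟩
  · have : (P.submatrix id e)ᵀ * P.submatrix id e = (Pᵀ * P).submatrix e e := by
      ext i j; simp [mul_apply]
    rw [this, hP, submatrix_one_equiv]
  · rw [hl]
    conv_lhs => rw [hs]
    ext i j
    rw [mul_apply, mul_apply, ← e.sum_comp]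
    simp [mul_diagonal]

/-- the spectral function -/
abbrev zt (b : Fin q → Fin n → ℝ) (d : Fin q → ℝ) (X : Matrix (Fin n) (Fin n) ℝ) : ℝ :=
  pwa b d (lamVec X)

lemma symm_conj {A : Matrix (Fin n) (Fin n) ℝ} (hA : A.IsSymm) (Q : Matrix (Fin n) (Fin n) ℝ) :
    (Qᵀ * A * Q).IsSymm := by
  rw [Matrix.IsSymm, transpose_mul, transpose_mul, transpose_transpose, hA.eq, Matrix.mul_assoc]

lemma K1 (b : Fin q → Fin n → ℝ) (d : Fin q → ℝ)
    (hsym : ∀ (σ : Equiv.Perm (Fin n)) (x : Fin n → ℝ), pwa b d (x ∘ σ) = pwa b d x)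
    (Y : Matrix (Fin n) (Fin n) ℝ) (hY : Y.IsSymm) (Q : Matrix (Fin n) (Fin n) ℝ)
    (hQ : Qᵀ * Q = 1) : pwa b d (Qᵀ * Y * Q).diag ≤ zt b d Y := by
  obtain ⟨U, hU, hYU⟩ := exists_OSet Y hY
  have h1 : Qᵀ * Y * Q = (Uᵀ * Q)ᵀ * diagonal (lamVec Y) * (Uᵀ * Q) := by
    conv_lhs => rw [hYU]
    simp only [transpose_mul, transpose_transpose, Matrix.mul_assoc]
  rw [h1]
  refine schur b d hsym _ ?_ _
  have hU' : U * Uᵀ = 1 := mul_eq_one_comm.mp hU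
  calc (Uᵀ * Q)ᵀ * (Uᵀ * Q) = Qᵀ * (U * Uᵀ) * Q := by
        simp only [transpose_mul, transpose_transpose, Matrix.mul_assoc]
    _ = 1 := by rw [hU', Matrix.mul_one, hQ]

lemma K2 (b : Fin q → Fin n → ℝ) (d : Fin q → ℝ)
    (hsym : ∀ (σ : Equiv.Perm (Fin n)) (x : Fin n → ℝ), pwa b d (x ∘ σ) = pwa b d x)
    (Y : Matrix (Fin n) (Fin n) ℝ) (hY : Y.IsSymm) (Q : Matrix (Fin n) (Fin n) ℝ)
    (hQ : Qᵀ * Q = 1) (y : Fin n → ℝ) (hy : Qᵀ * Y * Q = diagonal y) : zt b d Y = pwa b d y := by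
  apply le_antisymm
  · obtain ⟨U, hU, hYU⟩ := exists_OSet Y hY
    have hQ' : Q * Qᵀ = 1 := mul_eq_one_comm.mp hQ
    have h1 : diagonal (lamVec Y) = (Qᵀ * U)ᵀ * diagonal y * (Qᵀ * U) := by
      rw [← hy]
      calc diagonal (lamVec Y) = (Uᵀ * U) * diagonal (lamVec Y) * (Uᵀ * U) := by rw [hU]; simp
        _ = Uᵀ * (U * diagonal (lamVec Y) * Uᵀ) * U := by simp only [Matrix.mul_assoc]
        _ = Uᵀ * Y * U := by rw [← hYU]
        _ = Uᵀ * (Q * Qᵀ) * Y * (Q * Qᵀ) * U := by rw [hQ']; simp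
        _ = _ := by simp only [transpose_mul, transpose_transpose, Matrix.mul_assoc]
    have h2 : (Qᵀ * U)ᵀ * (Qᵀ * U) = 1 := by
      calc (Qᵀ * U)ᵀ * (Qᵀ * U) = Uᵀ * (Q * Qᵀ) * U := by
            simp only [transpose_mul, transpose_transpose, Matrix.mul_assoc]
        _ = 1 := by rw [hQ', Matrix.mul_one, hU]
    have := schur b d hsym (Qᵀ * U) h2 y
    rwa [← h1, diag_diagonal] at this
  · have := K1 b d hsym Y hY Q hQ
    rwa [hy, diag_diagonal] at this

lemma zt_conj (b : Fin q → Fin n → ℝ) (d : Fin q → ℝ)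
    (hsym : ∀ (σ : Equiv.Perm (Fin n)) (x : Fin n → ℝ), pwa b d (x ∘ σ) = pwa b d x)
    (Y : Matrix (Fin n) (Fin n) ℝ) (hY : Y.IsSymm) (Q : Matrix (Fin n) (Fin n) ℝ)
    (hQ : Qᵀ * Q = 1) : zt b d (Qᵀ * Y * Q) = zt b d Y := by
  obtain ⟨U, hU, hYU⟩ := exists_OSet (Qᵀ * Y * Q) (symm_conj hY Q)
  symm
  refine K2 b d hsym Y hY (Q * U) ?_ _ ?_
  · calc (Q * U)ᵀ * (Q * U) = Uᵀ * (Qᵀ * Q) * U := by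
            simp only [transpose_mul, Matrix.mul_assoc]
        _ = 1 := by rw [hQ, Matrix.mul_one, hU]
  · calc (Q * U)ᵀ * Y * (Q * U) = Uᵀ * (Qᵀ * Y * Q) * U := by
            simp only [transpose_mul, Matrix.mul_assoc]
      _ = Uᵀ * (U * diagonal (lamVec (Qᵀ * Y * Q)) * Uᵀ) * U := by rw [← hYU]
      _ = (Uᵀ * U) * diagonal (lamVec (Qᵀ * Y * Q)) * (Uᵀ * U) := by
        simp only [Matrix.mul_assoc]
      _ = _ := by rw [hU]; simp

/-- entrywise l1 norm -/
def N (E : Matrix (Fin n) (Fin n) ℝ) : ℝ := ∑ i, ∑ j, |E i j|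

lemma N_nonneg (E : Matrix (Fin n) (Fin n) ℝ) : 0 ≤ N E :=
  Finset.sum_nonneg fun _ _ => Finset.sum_nonneg fun _ _ => abs_nonneg _

lemma N_add (A B : Matrix (Fin n) (Fin n) ℝ) : N (A + B) ≤ N A + N B := by
  simp only [N, ← Finset.sum_add_distrib]
  exact Finset.sum_le_sum fun _ _ => Finset.sum_le_sum fun _ _ => abs_add_le _ _

lemma N_smul (c : ℝ) (A : Matrix (Fin n) (Fin n) ℝ) : N (c • A) = |c| * N A := by
  simp only [N, Finset.mul_sum, Matrix.smul_apply, smul_eq_mul, abs_mul]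

lemma N_transpose (A : Matrix (Fin n) (Fin n) ℝ) : N Aᵀ = N A := by
  simp only [N, transpose_apply]; exact Finset.sum_comm

lemma N_neg (A : Matrix (Fin n) (Fin n) ℝ) : N (-A) = N A := by
  simp [N]

lemma N_mul_left (A B : Matrix (Fin n) (Fin n) ℝ) (hA : ∀ i j, |A i j| ≤ 1) :
    N (A * B) ≤ n * N B := by
  have : ∀ i, ∑ j, |(A * B) i j| ≤ N B := by
    intro i
    rw [N, Finset.sum_comm]
    refine Finset.sum_le_sum fun j _ => ?_
    rw [mul_apply]
    refine (Finset.abs_sum_le_sum_abs _ _).trans (Finset.sum_le_sum fun k _ => ?_)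
    rw [abs_mul]
    exact mul_le_of_le_one_left (abs_nonneg _) (hA _ _)
  calc N (A * B) ≤ ∑ i : Fin n, N B := Finset.sum_le_sum fun i _ => this i
    _ = _ := by simp

lemma N_mul_right (A B : Matrix (Fin n) (Fin n) ℝ) (hA : ∀ i j, |A i j| ≤ 1) :
    N (B * A) ≤ n * N B := by
  rw [← N_transpose, transpose_mul, ← N_transpose B]
  exact N_mul_left _ _ fun i j => hA j i

lemma orth_entry (Q : Matrix (Fin n) (Fin n) ℝ) (hQ : Qᵀ * Q = 1) (i j : Fin n) :
    |Q i j| ≤ 1 := by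
  have := congrFun (congrFun hQ j) j
  simp only [mul_apply, transpose_apply, one_apply_eq] at this
  have h2 := Finset.single_le_sum (f := fun k => Q k j * Q k j)
    (fun k _ => mul_self_nonneg _) (Finset.mem_univ i)
  rw [abs_le_one_iff_mul_self_le_one]
  simpa [this] using h2

lemma pwa_lip (b : Fin q → Fin n → ℝ) (d : Fin q → ℝ) (x y : Fin n → ℝ) :
    pwa b d x ≤ pwa b d y + (∑ k, ∑ i, |b k i|) * ∑ i, |x i - y i| := by
  refine pwa_le _ _ _ _ fun k => ?_
  have h1 := le_pwa b d y k
  have h2 : b k ⬝ᵥ x - b k ⬝ᵥ y ≤ (∑ k, ∑ i, |b k i|) * ∑ i, |x i - y i| := by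
    rw [← dotProduct_sub, dotProduct, Finset.mul_sum]
    refine Finset.sum_le_sum fun i _ => ?_
    refine (le_abs_self _).trans ?_
    rw [abs_mul]
    refine mul_le_mul_of_nonneg_right ?_ (abs_nonneg _)
    calc |b k i| ≤ ∑ i, |b k i| :=
          Finset.single_le_sum (f := fun i => |b k i|) (fun _ _ => abs_nonneg _)
            (Finset.mem_univ i)
      _ ≤ _ := Finset.single_le_sum (f := fun k => ∑ i, |b k i|)
            (fun _ _ => Finset.sum_nonneg fun _ _ => abs_nonneg _) (Finset.mem_univ k)
  linarith

lemma zt_lip1 (b : Fin q → Fin n → ℝ) (d : Fin q → ℝ)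
    (hsym : ∀ (σ : Equiv.Perm (Fin n)) (x : Fin n → ℝ), pwa b d (x ∘ σ) = pwa b d x) :
    ∃ C : ℝ, 0 ≤ C ∧ ∀ A B : Matrix (Fin n) (Fin n) ℝ, A.IsSymm → B.IsSymm →
      zt b d A ≤ zt b d B + C * N (A - B) := by
  refine ⟨(∑ k, ∑ i, |b k i|) * (n * n), by positivity, fun A B hA hB => ?_⟩
  obtain ⟨Q, hQ, hAQ⟩ := exists_OSet A hA
  have h1 : Qᵀ * A * Q = diagonal (lamVec A) := by
    calc Qᵀ * A * Q = Qᵀ * (Q * diagonal (lamVec A) * Qᵀ) * Q := by rw [← hAQ]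
      _ = (Qᵀ * Q) * diagonal (lamVec A) * (Qᵀ * Q) := by simp only [Matrix.mul_assoc]
      _ = _ := by rw [hQ]; simp
  have h2 : lamVec A = (Qᵀ * A * Q).diag := by rw [h1, diag_diagonal]
  have h3 := pwa_lip b d (Qᵀ * A * Q).diag (Qᵀ * B * Q).diag
  have h4 := K1 b d hsym B hB Q hQ
  have h5 : ∑ i, |(Qᵀ * A * Q).diag i - (Qᵀ * B * Q).diag i| ≤ (n * n) * N (A - B) := by
    calc _ ≤ N (Qᵀ * (A - B) * Q) := by
          refine Finset.sum_le_sum fun i _ => ?_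
          rw [Matrix.mul_sub, Matrix.sub_mul]
          exact Finset.single_le_sum
            (f := fun j => |(Qᵀ * A * Q - Qᵀ * B * Q) i j|) (fun _ _ => abs_nonneg _)
            (Finset.mem_univ i)
      _ ≤ n * N (Qᵀ * (A - B)) := N_mul_right _ _ (orth_entry Q hQ)
      _ ≤ n * (n * N (A - B)) := by
          refine mul_le_mul_of_nonneg_left ?_ (Nat.cast_nonneg n)
          exact N_mul_left _ _ fun i j => orth_entry Q hQ j i
      _ = _ := by ring
  have h6 : 0 ≤ ∑ k, ∑ i, |b k i| := by positivity
  rw [zt, h2]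
  have := mul_le_mul_of_nonneg_left h5 h6
  rw [zt] at h4 ⊢
  linarith

lemma zt_lip (b : Fin q → Fin n → ℝ) (d : Fin q → ℝ)
    (hsym : ∀ (σ : Equiv.Perm (Fin n)) (x : Fin n → ℝ), pwa b d (x ∘ σ) = pwa b d x) :
    ∃ C : ℝ, 0 ≤ C ∧ ∀ A B : Matrix (Fin n) (Fin n) ℝ, A.IsSymm → B.IsSymm →
      |zt b d A - zt b d B| ≤ C * N (A - B) := by
  obtain ⟨C, hC, h⟩ := zt_lip1 b d hsym
  refine ⟨C, hC, fun A B hA hB => abs_le.mpr ⟨?_, ?_⟩⟩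
  · have := h B A hB hA
    rw [← N_neg, neg_sub] at this
    linarith
  · linarith [h A B hA hB]

lemma zt_convex (b : Fin q → Fin n → ℝ) (d : Fin q → ℝ)
    (hsym : ∀ (σ : Equiv.Perm (Fin n)) (x : Fin n → ℝ), pwa b d (x ∘ σ) = pwa b d x)
    (A B : Matrix (Fin n) (Fin n) ℝ) (hA : A.IsSymm) (hB : B.IsSymm) (s : ℝ) (hs0 : 0 ≤ s)
    (hs1 : s ≤ 1) : zt b d ((1 - s) • A + s • B) ≤ (1 - s) * zt b d A + s * zt b d B := by
  have hY : ((1 - s) • A + s • B).IsSymm := (hA.smul _).add (hB.smul _)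
  obtain ⟨Q, hQ, hAQ⟩ := exists_OSet _ hY
  set Y := (1 - s) • A + s • B with hYdef
  have h1 : Qᵀ * Y * Q = diagonal (lamVec Y) := by
    calc Qᵀ * Y * Q = Qᵀ * (Q * diagonal (lamVec Y) * Qᵀ) * Q := by rw [← hAQ]
      _ = (Qᵀ * Q) * diagonal (lamVec Y) * (Qᵀ * Q) := by simp only [Matrix.mul_assoc]
      _ = _ := by rw [hQ]; simp
  have h2 : lamVec Y = (1 - s) • (Qᵀ * A * Q).diag + s • (Qᵀ * B * Q).diag := by
    rw [← diag_diagonal (lamVec Y), ← h1, hYdef]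
    simp [Matrix.mul_add, Matrix.add_mul]
  refine pwa_le _ _ _ _ fun i => ?_
  rw [h2, dotProduct_add, dotProduct_smul, dotProduct_smul, smul_eq_mul, smul_eq_mul]
  have hA' := (le_pwa b d _ i).trans (K1 b d hsym A hA Q hQ)
  have hB' := (le_pwa b d _ i).trans (K1 b d hsym B hB Q hQ)
  nlinarith [mul_le_mul_of_nonneg_left hA' (sub_nonneg.mpr hs1),
    mul_le_mul_of_nonneg_left hB' hs0]

/-- comparison through a Cayley rotation -/
lemma cayley (b : Fin q → Fin n → ℝ) (d : Fin q → ℝ)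
    (hsym : ∀ (σ : Equiv.Perm (Fin n)) (x : Fin n → ℝ), pwa b d (x ∘ σ) = pwa b d x) :
    ∃ C : ℝ, 0 ≤ C ∧ ∀ A B S : Matrix (Fin n) (Fin n) ℝ, A.IsSymm → B.IsSymm → Sᵀ = -S →
      |zt b d A - zt b d B| ≤ C * N ((1 - S) * A * (1 + S) - (1 + S) * B * (1 - S)) := by
  obtain ⟨C, hC, hL⟩ := zt_lip b d hsym
  refine ⟨C * (n * (n * n)), by positivity, fun A B S hA hB hS => ?_⟩
  have hdet : IsUnit (1 - S) := by
    rw [← Matrix.mulVec_injective_iff_isUnit]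
    intro u v huv
    have h0 : (1 - S) *ᵥ (u - v) = 0 := by rw [mulVec_sub, sub_eq_zero]; exact huv
    rw [sub_mulVec, one_mulVec, sub_eq_zero] at h0
    have h1 : (u - v) ⬝ᵥ (S *ᵥ (u - v)) = 0 := by
      have : (u - v) ⬝ᵥ (S *ᵥ (u - v)) = - ((u - v) ⬝ᵥ (S *ᵥ (u - v))) := by
        conv_lhs => rw [dotProduct_mulVec, ← mulVec_transpose, hS, neg_mulVec, neg_dotProduct,
          dotProduct_comm]
      linarith
    rw [← h0] at h1
    exact sub_eq_zero.mp (dotProduct_self_eq_zero.mp h1)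
  obtain ⟨P, hP1, hP2⟩ := isUnit_iff_exists.mp hdet
  have hPT1 : Pᵀ * (1 + S) = 1 := by
    have := congrArg transpose hP1
    simpa [transpose_mul, hS] using this
  have hPT2 : (1 + S) * Pᵀ = 1 := by
    have := congrArg transpose hP2
    simpa [transpose_mul, hS] using this
  have hcomm : (1 + S) * (1 - S) = (1 - S) * (1 + S) := by noncomm_ring
  have hPent : ∀ i j, |P i j| ≤ 1 := by
    intro i j
    have h1 : Pᵀ * P + (S * P)ᵀ * (S * P) = 1 := by
      calc Pᵀ * P + (S * P)ᵀ * (S * P) = Pᵀ * ((1 + S) * (1 - S)) * P := by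
            rw [transpose_mul, hS]; noncomm_ring
        _ = (Pᵀ * (1 + S)) * ((1 - S) * P) := by noncomm_ring
        _ = 1 := by rw [hPT1, hP1, one_mul]
    have := congrFun (congrFun h1 j) j
    simp only [Matrix.add_apply, mul_apply, transpose_apply, one_apply_eq] at this
    have h2 := Finset.single_le_sum (f := fun k => P k j * P k j)
      (fun k _ => mul_self_nonneg _) (Finset.mem_univ i)
    have h3 : 0 ≤ ∑ x, (∑ k, S x k * P k j) * ∑ k, S x k * P k j :=
      Finset.sum_nonneg fun k _ => mul_self_nonneg _
    rw [abs_le_one_iff_mul_self_le_one]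
    refine h2.trans ?_
    linarith
  set U := (1 + S) * P with hU
  have hUU : Uᵀ * U = 1 := by
    rw [hU, transpose_mul]
    have : (1 + S)ᵀ = 1 - S := by simp [hS, sub_eq_add_neg]
    rw [this]
    calc Pᵀ * (1 - S) * ((1 + S) * P) = Pᵀ * ((1 - S) * (1 + S)) * P := by noncomm_ring
      _ = (Pᵀ * (1 + S)) * ((1 - S) * P) := by rw [← hcomm]; noncomm_ring
      _ = 1 := by rw [hPT1, hP1, one_mul]
  have hU2 : U = P * (1 + S) := by
    calc U = (P * (1 - S)) * ((1 + S) * P) := by rw [hP2, one_mul]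
      _ = P * ((1 - S) * (1 + S)) * P := by noncomm_ring
      _ = P * (1 + S) * ((1 - S) * P) := by rw [← hcomm]; noncomm_ring
      _ = P * (1 + S) := by rw [hP1, mul_one]
  have hkey : Uᵀ * A * U - B
      = Uᵀ * (P * ((1 - S) * A * (1 + S) - (1 + S) * B * (1 - S)) * P) := by
    have : P * ((1 - S) * A * (1 + S) - (1 + S) * B * (1 - S)) * P = A * U - U * B := by
      calc _ = (P * (1 - S)) * A * ((1 + S) * P) - (P * (1 + S)) * B * ((1 - S) * P) := by
            noncomm_ring
        _ = _ := by rw [hP1, hP2, ← hU, ← hU2, one_mul, mul_one]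
    rw [this, mul_sub, ← mul_assoc Uᵀ U B, hUU, one_mul, mul_assoc]
  rw [← zt_conj b d hsym A hA U hUU]
  refine (hL _ _ (symm_conj hA U) hB).trans ?_
  rw [mul_assoc C, hkey]
  refine mul_le_mul_of_nonneg_left ?_ hC
  refine (N_mul_left _ _ fun i j => orth_entry U hUU j i).trans ?_
  rw [mul_assoc (n : ℝ)]
  refine mul_le_mul_of_nonneg_left ?_ (Nat.cast_nonneg n)
  refine (N_mul_right _ _ hPent).trans ?_
  rw [mul_assoc (n : ℝ)]
  refine mul_le_mul_of_nonneg_left ?_ (Nat.cast_nonneg n)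
  exact N_mul_left _ _ hPent

lemma expand (b : Fin q → Fin n → ℝ) (d : Fin q → ℝ)
    (hsym : ∀ (σ : Equiv.Perm (Fin n)) (x : Fin n → ℝ), pwa b d (x ∘ σ) = pwa b d x)
    (D X1 X2 B1 B2 A1 A2 : Matrix (Fin n) (Fin n) ℝ)
    (hD : D.IsSymm) (hX1 : X1.IsSymm) (hX2 : X2.IsSymm) (hB1 : B1.IsSymm) (hB2 : B2.IsSymm)
    (hA1 : A1ᵀ = -A1) (hA2 : A2ᵀ = -A2)
    (h1 : X1 - B1 + (2 : ℝ) • (D * A1 - A1 * D) = 0)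
    (h2 : X2 - B2 + (2 : ℝ) • (D * A2 - A2 * D) + ((X1 + B1) * A1 - A1 * (X1 + B1)) = 0) :
    ∃ C : ℝ, 0 ≤ C ∧ ∀ t : ℝ, 0 ≤ t → t ≤ 1 →
      |zt b d (D + t • X1 + t ^ 2 • X2) - zt b d (D + t • B1 + t ^ 2 • B2)| ≤ C * t ^ 3 := by
  obtain ⟨C, hC, hL⟩ := cayley b d hsym
  set F3 := (X1 + B1) * A2 - A2 * (X1 + B1) + ((X2 + B2) * A1 - A1 * (X2 + B2))
    - A1 * (X1 - B1) * A1 with hF3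
  set F4 := (X2 + B2) * A2 - A2 * (X2 + B2) - A1 * (X2 - B2) * A1 - A1 * (X1 - B1) * A2
    - A2 * (X1 - B1) * A1 with hF4
  set F5 := -(A1 * (X2 - B2) * A2 + A2 * (X2 - B2) * A1 + A2 * (X1 - B1) * A2) with hF5
  set F6 := -(A2 * (X2 - B2) * A2) with hF6
  refine ⟨C * (N F3 + N F4 + N F5 + N F6), ?_, fun t ht0 ht1 => ?_⟩
  · have := N_nonneg F3
    have := N_nonneg F4
    have := N_nonneg F5
    have := N_nonneg F6
    positivity
  have hS : (t • A1 + t ^ 2 • A2)ᵀ = -(t • A1 + t ^ 2 • A2) := by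
    rw [transpose_add, transpose_smul, transpose_smul, hA1, hA2]; module
  refine (hL _ _ _ ((hD.add (hX1.smul _)).add (hX2.smul _))
    ((hD.add (hB1.smul _)).add (hB2.smul _)) hS).trans ?_
  have hE : (1 - (t • A1 + t ^ 2 • A2)) * (D + t • X1 + t ^ 2 • X2) * (1 + (t • A1 + t ^ 2 • A2))
      - (1 + (t • A1 + t ^ 2 • A2)) * (D + t • B1 + t ^ 2 • B2) * (1 - (t • A1 + t ^ 2 • A2))
      = t • (X1 - B1 + (2 : ℝ) • (D * A1 - A1 * D)) +
        t ^ 2 • (X2 - B2 + (2 : ℝ) • (D * A2 - A2 * D) + ((X1 + B1) * A1 - A1 * (X1 + B1))) +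
        (t ^ 3 • F3 + t ^ 4 • F4 + t ^ 5 • F5 + t ^ 6 • F6) := by
    rw [hF3, hF4, hF5, hF6]
    simp only [mul_add, add_mul, mul_sub, sub_mul, smul_mul_assoc, mul_smul_comm, one_mul, mul_one,
      mul_assoc]
    module
  rw [hE, h1, h2, smul_zero, smul_zero, zero_add, zero_add, mul_assoc]
  refine mul_le_mul_of_nonneg_left ?_ hC
  have e : ∀ (k : ℕ) (F : Matrix (Fin n) (Fin n) ℝ), 3 ≤ k → N (t ^ k • F) ≤ N F * t ^ 3 := by
    intro k F hk
    rw [N_smul, abs_of_nonneg (by positivity), mul_comm]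
    exact mul_le_mul_of_nonneg_left (pow_le_pow_of_le_one ht0 ht1 hk) (N_nonneg F)
  calc _ ≤ N (t ^ 3 • F3) + N (t ^ 4 • F4) + N (t ^ 5 • F5) + N (t ^ 6 • F6) := by
        refine (N_add _ _).trans (add_le_add_left ((N_add _ _).trans
          (add_le_add_left (N_add _ _) _)) _)
    _ ≤ _ := by
        have a3 := e 3 F3 (by norm_num)
        have a4 := e 4 F4 (by norm_num)
        have a5 := e 5 F5 (by norm_num)
        have a6 := e 6 F6 (by norm_num)
        linarith

/-- block part -/
def blk {β : Type*} (f : Fin n → β) (A : Matrix (Fin n) (Fin n) ℝ) : Matrix (Fin n) (Fin n) ℝ :=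
  Matrix.of fun i j => if f i = f j then A i j else 0

lemma blk_symm {β : Type*} (f : Fin n → β) {A : Matrix (Fin n) (Fin n) ℝ} (hA : A.IsSymm) :
    (blk f A).IsSymm := by
  ext i j
  simp only [blk, transpose_apply, of_apply, eq_comm (a := f j)]
  rw [hA.apply]

/-- the optimal second-order direction -/
def Wst (x : Fin n → ℝ) (H : Matrix (Fin n) (Fin n) ℝ) : Matrix (Fin n) (Fin n) ℝ :=
  Matrix.of fun i j => if x i = x j then 2 * ∑ k, H i k * (x k - x i)⁻¹ * H k j else 0

lemma Wst_symm (x : Fin n → ℝ) {H : Matrix (Fin n) (Fin n) ℝ} (hH : H.IsSymm) :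
    (Wst x H).IsSymm := by
  ext i j
  simp only [Wst, transpose_apply, of_apply, eq_comm (a := x j)]
  split_ifs with h
  · rw [h]
    congr 1
    refine Finset.sum_congr rfl fun k _ => ?_
    rw [hH.apply k j, hH.apply i k]; ring
  · rfl

lemma diagonal_comm_apply (x : Fin n → ℝ) (A : Matrix (Fin n) (Fin n) ℝ) (i j : Fin n) :
    (diagonal x * A - A * diagonal x) i j = (x i - x j) * A i j := by
  rw [Matrix.sub_apply, diagonal_mul, mul_diagonal]; ring

lemma step1 (b : Fin q → Fin n → ℝ) (d : Fin q → ℝ)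
    (hsym : ∀ (σ : Equiv.Perm (Fin n)) (x : Fin n → ℝ), pwa b d (x ∘ σ) = pwa b d x)
    (x : Fin n → ℝ) (H W : Matrix (Fin n) (Fin n) ℝ) (hH : H.IsSymm) (hW : W.IsSymm) :
    ∃ C : ℝ, 0 ≤ C ∧ ∀ t : ℝ, 0 ≤ t → t ≤ 1 →
      |zt b d (diagonal x + t • H + (t ^ 2 / 2) • W)
        - zt b d (diagonal x + t • blk x H + (t ^ 2 / 2) • blk x (W - Wst x H))| ≤ C * t ^ 3 := by
  set A1 : Matrix (Fin n) (Fin n) ℝ := Matrix.of fun i j => H i j * (2 * (x j - x i))⁻¹ with hA1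
  set T : Matrix (Fin n) (Fin n) ℝ := (1 / 2 : ℝ) • W - (1 / 2 : ℝ) • blk x (W - Wst x H) +
    ((H + blk x H) * A1 - A1 * (H + blk x H)) with hT
  set A2 : Matrix (Fin n) (Fin n) ℝ := Matrix.of fun i j => T i j * (2 * (x j - x i))⁻¹ with hA2
  have hM : (blk x (W - Wst x H)).IsSymm := blk_symm x (hW.sub (Wst_symm x hH))
  have hA1s : A1ᵀ = -A1 := by
    ext i j
    simp only [hA1, transpose_apply, Matrix.neg_apply, of_apply]
    rw [hH.apply i j, ← neg_sub (x j) (x i), mul_neg, inv_neg, mul_neg]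
  have hTs : T.IsSymm := by
    rw [Matrix.IsSymm, hT]
    simp only [transpose_add, transpose_sub, transpose_mul, transpose_smul, hA1s, hW.eq, hM.eq,
      hH.eq, (blk_symm x hH).eq]
    noncomm_ring
  have hA2s : A2ᵀ = -A2 := by
    ext i j
    simp only [hA2, transpose_apply, Matrix.neg_apply, of_apply]
    rw [hTs.apply i j, ← neg_sub (x j) (x i), mul_neg, inv_neg, mul_neg]
  have hT0 : ∀ i j, x i = x j → T i j = 0 := by
    intro i j hij
    rw [hT]
    simp only [Matrix.add_apply, Matrix.sub_apply, Matrix.smul_apply, mul_apply, blk, of_apply,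
      if_pos hij, Wst, hA1, smul_eq_mul]
    have : ∑ k, (H i k + if x i = x k then H i k else 0) * (H k j * (2 * (x j - x k))⁻¹)
        - ∑ k, H i k * (2 * (x k - x i))⁻¹ * (H k j + if x k = x j then H k j else 0)
        = - ∑ k, H i k * (x k - x i)⁻¹ * H k j := by
      rw [← Finset.sum_sub_distrib, ← Finset.sum_neg_distrib]
      refine Finset.sum_congr rfl fun k _ => ?_
      rw [← hij]
      by_cases hk : x i = x k
      · simp [hk]
      · rw [if_neg hk, if_neg (Ne.symm hk), ← neg_sub (x k) (x i), mul_neg, inv_neg, mul_inv]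
        ring
    rw [this]; ring
  obtain ⟨C, hC, h⟩ := expand b d hsym (diagonal x) H ((1 / 2 : ℝ) • W) (blk x H)
    ((1 / 2 : ℝ) • blk x (W - Wst x H)) A1 A2 (diagonal_transpose x) hH (hW.smul _)
    (blk_symm x hH) (hM.smul _) hA1s hA2s
    (by
      ext i j
      rw [Matrix.add_apply, Matrix.smul_apply, diagonal_comm_apply]
      simp only [hA1, Matrix.sub_apply, blk, of_apply, smul_eq_mul, Matrix.zero_apply]
      by_cases hij : x i = x j
      · simp [hij]
      · have h2 : x j - x i ≠ 0 := sub_ne_zero.mpr (Ne.symm hij)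
        rw [if_neg hij]
        field_simp
        ring)
    (by
      have : (1 / 2 : ℝ) • W - (1 / 2 : ℝ) • blk x (W - Wst x H) +
          (2 : ℝ) • (diagonal x * A2 - A2 * diagonal x) +
          ((H + blk x H) * A1 - A1 * (H + blk x H)) =
          T + (2 : ℝ) • (diagonal x * A2 - A2 * diagonal x) := by rw [hT]; abel
      rw [this]
      ext i j
      rw [Matrix.add_apply, Matrix.smul_apply, diagonal_comm_apply]
      simp only [hA2, of_apply, smul_eq_mul, Matrix.zero_apply]
      by_cases hij : x i = x j
      · simp [hij, hT0 i j hij]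
      · have h2 : x j - x i ≠ 0 := sub_ne_zero.mpr (Ne.symm hij)
        field_simp
        ring)
  refine ⟨C, hC, fun t h0 h1 => ?_⟩
  have := h t h0 h1
  rw [smul_smul, smul_smul, mul_one_div] at this
  exact this

lemma step3 (b : Fin q → Fin n → ℝ) (d : Fin q → ℝ)
    (hsym : ∀ (σ : Equiv.Perm (Fin n)) (x : Fin n → ℝ), pwa b d (x ∘ σ) = pwa b d x)
    (x μ : Fin n → ℝ) (M : Matrix (Fin n) (Fin n) ℝ) (hM : M.IsSymm)
    (hMb : ∀ i j, x i ≠ x j → M i j = 0) :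
    ∃ C : ℝ, 0 ≤ C ∧ ∀ t : ℝ, 0 ≤ t → t ≤ 1 →
      |zt b d (diagonal x + t • diagonal μ + (t ^ 2 / 2) • M)
        - zt b d (diagonal x + t • diagonal μ + (t ^ 2 / 2) • blk μ M)| ≤ C * t ^ 3 := by
  set A : Matrix (Fin n) (Fin n) ℝ := Matrix.of fun i j => M i j * (4 * (μ j - μ i))⁻¹ with hA
  have hAs : Aᵀ = -A := by
    ext i j
    simp only [hA, transpose_apply, Matrix.neg_apply, of_apply]
    rw [hM.apply i j, ← neg_sub (μ j) (μ i), mul_neg, inv_neg, mul_neg]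
  obtain ⟨C, hC, h⟩ := expand b d hsym (diagonal x) (diagonal μ) ((1 / 2 : ℝ) • M) (diagonal μ)
    ((1 / 2 : ℝ) • blk μ M) A 0 (diagonal_transpose x) (diagonal_transpose μ) (hM.smul _)
    (diagonal_transpose μ) ((blk_symm μ hM).smul _) hAs (by simp)
    (by
      ext i j
      rw [Matrix.add_apply, Matrix.smul_apply, diagonal_comm_apply]
      simp only [hA, Matrix.sub_apply, of_apply, smul_eq_mul, Matrix.zero_apply]
      by_cases hij : x i = x j
      · simp [hij]
      · simp [hMb i j hij])
    (by
      have : (diagonal μ + diagonal μ) * A - A * (diagonal μ + diagonal μ) =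
          (2 : ℝ) • (diagonal μ * A - A * diagonal μ) := by
        rw [two_smul]; noncomm_ring
      rw [this]
      ext i j
      simp only [Matrix.add_apply, Matrix.smul_apply, diagonal_comm_apply]
      simp only [hA, Matrix.sub_apply, Matrix.smul_apply, of_apply, smul_eq_mul,
        Matrix.zero_apply, blk]
      by_cases hij : μ i = μ j
      · simp [hij]
      · have h2 : μ j - μ i ≠ 0 := sub_ne_zero.mpr (Ne.symm hij)
        rw [if_neg hij]
        field_simp
        ring)
  refine ⟨C, hC, fun t h0 h1 => ?_⟩
  have := h t h0 h1
  rw [smul_smul, smul_smul, mul_one_div] at this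
  exact this

/-- block matrices -/
def IsBlk {β : Type*} (f : Fin n → β) (A : Matrix (Fin n) (Fin n) ℝ) : Prop :=
  ∀ i j, f i ≠ f j → A i j = 0

lemma IsBlk.mul {β : Type*} {f : Fin n → β} {A B : Matrix (Fin n) (Fin n) ℝ}
    (hA : IsBlk f A) (hB : IsBlk f B) : IsBlk f (A * B) := by
  intro i j hij
  rw [mul_apply]
  refine Finset.sum_eq_zero fun k _ => ?_
  by_cases h : f i = f k
  · rw [hB k j (fun h' => hij (h.trans h')), mul_zero]
  · rw [hA i k h, zero_mul]

lemma IsBlk.transpose {β : Type*} {f : Fin n → β} {A : Matrix (Fin n) (Fin n) ℝ}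
    (hA : IsBlk f A) : IsBlk f Aᵀ := fun i j hij => hA j i (Ne.symm hij)

lemma IsBlk.sub_mul {β : Type*} {f : Fin n → β} {A B : Matrix (Fin n) (Fin n) ℝ}
    (hA : IsBlk f A) (v : β) :
    (A * B).submatrix (Subtype.val : {i // f i = v} → Fin n) (Subtype.val : {i // f i = v} → Fin n)
      = A.submatrix Subtype.val Subtype.val * B.submatrix Subtype.val Subtype.val := by
  ext i j
  simp only [submatrix_apply, mul_apply]
  rw [← Fintype.sum_subtype_add_sum_subtype (fun k => f k = v)]
  have : ∑ k : {k // ¬ f k = v}, A i k * B k j = 0 := by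
    refine Finset.sum_eq_zero fun k _ => ?_
    rw [hA i k (fun h => k.2 (h.symm.trans i.2)), zero_mul]
  rw [this, add_zero]

lemma block_diag {β : Type*} (f : Fin n → β) (B : Matrix (Fin n) (Fin n) ℝ) (hB : B.IsSymm)
    (hBb : IsBlk f B) : ∃ R : Matrix (Fin n) (Fin n) ℝ, Rᵀ * R = 1 ∧ IsBlk f R ∧
      ∃ ν : Fin n → ℝ, Rᵀ * B * R = Matrix.diagonal ν := by
  have hex : ∀ v : β, ∃ U : Matrix {i // f i = v} {i // f i = v} ℝ, Uᵀ * U = 1 ∧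
      ∃ ν : {i // f i = v} → ℝ, Uᵀ * B.submatrix Subtype.val Subtype.val * U = Matrix.diagonal ν := by
    intro v
    have h : (B.submatrix (Subtype.val : {i // f i = v} → Fin n)
        (Subtype.val : {i // f i = v} → Fin n)).IsHermitian := by
      rw [Matrix.IsHermitian, conjTranspose_eq_transpose_of_trivial, transpose_submatrix, hB.eq]
    have hP : (h.eigenvectorUnitary : Matrix {i // f i = v} {i // f i = v} ℝ)ᵀ
        * (h.eigenvectorUnitary : Matrix {i // f i = v} {i // f i = v} ℝ) = 1 := by
      have := Unitary.coe_star_mul_self h.eigenvectorUnitary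
      rwa [star_eq_conjTranspose, conjTranspose_eq_transpose_of_trivial] at this
    refine ⟨h.eigenvectorUnitary.1, hP, h.eigenvalues, ?_⟩
    have hs := h.spectral_theorem
    rw [Unitary.conjStarAlgAut_apply, star_eq_conjTranspose,
      conjTranspose_eq_transpose_of_trivial] at hs
    set P : Matrix {i // f i = v} {i // f i = v} ℝ := h.eigenvectorUnitary.1
    set L := Matrix.diagonal (RCLike.ofReal ∘ h.eigenvalues : _ → ℝ) with hL
    calc _ = Pᵀ * (P * L * Pᵀ) * P := by rw [← hs]
      _ = (Pᵀ * P) * L * (Pᵀ * P) := by simp only [Matrix.mul_assoc]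
      _ = L := by rw [hP]; simp
      _ = _ := rfl
  choose U hU ν hν using hex
  set R : Matrix (Fin n) (Fin n) ℝ :=
    Matrix.of fun i j => if h : f i = f j then U (f j) ⟨i, h⟩ ⟨j, rfl⟩ else 0 with hR
  have hRb : IsBlk f R := fun i j hij => by simp [hR, hij]
  have hRs : ∀ v, R.submatrix (Subtype.val : {i // f i = v} → Fin n)
      (Subtype.val : {i // f i = v} → Fin n) = U v := by
    intro v
    ext ⟨i, hi⟩ ⟨j, hj⟩
    subst hj
    simp [hR, hi]
  have hRTs : ∀ v, Rᵀ.submatrix (Subtype.val : {i // f i = v} → Fin n)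
      (Subtype.val : {i // f i = v} → Fin n) = (U v)ᵀ := by
    intro v; rw [← hRs v, transpose_submatrix]
  refine ⟨R, ?_, hRb, (Rᵀ * B * R).diag, ?_⟩
  · ext i j
    by_cases hij : f i = f j
    · have h1 := hRb.transpose.sub_mul (B := R) (f j)
      rw [hRs, hRTs, hU] at h1
      have := congrFun (congrFun h1 ⟨i, hij⟩) ⟨j, rfl⟩
      rw [submatrix_apply] at this
      rw [this, one_apply, one_apply]
      simp
    · rw [(hRb.transpose.mul hRb) i j hij, one_apply_ne (fun h => hij (by rw [h]))]
  · ext i j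
    by_cases h : i = j
    · subst h; simp
    rw [diagonal_apply_ne _ h]
    by_cases hij : f i = f j
    · have h1 := (hRb.transpose.mul hBb).sub_mul (B := R) (f j)
      rw [hRb.transpose.sub_mul, hRs, hRTs, hν] at h1
      have := congrFun (congrFun h1 ⟨i, hij⟩) ⟨j, rfl⟩
      rw [submatrix_apply] at this
      rw [this, diagonal_apply_ne]
      simpa using h
    · exact ((hRb.transpose.mul hBb).mul hRb) i j hij

lemma IsBlk.conj_diag {β : Type*} {f : Fin n → β} {R : Matrix (Fin n) (Fin n) ℝ}
    (hR : IsBlk f R) (hRR : Rᵀ * R = 1) (x : Fin n → ℝ) (hx : ∀ i j, f i = f j → x i = x j) :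
    Rᵀ * diagonal x * R = diagonal x := by
  have : diagonal x * R = R * diagonal x := by
    ext i j
    rw [diagonal_mul, mul_diagonal]
    by_cases h : f i = f j
    · rw [hx i j h, mul_comm]
    · rw [hR i j h]; simp
  rw [Matrix.mul_assoc, this, ← Matrix.mul_assoc, hRR, Matrix.one_mul]

lemma propE (b : Fin q → Fin n → ℝ) (d : Fin q → ℝ)
    (hsym : ∀ (σ : Equiv.Perm (Fin n)) (x : Fin n → ℝ), pwa b d (x ∘ σ) = pwa b d x)
    (x : Fin n → ℝ) (H W : Matrix (Fin n) (Fin n) ℝ) (hH : H.IsSymm) (hW : W.IsSymm) :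
    ∃ C : ℝ, 0 ≤ C ∧ ∃ μ ν : Fin n → ℝ, (W = Wst x H → ν = 0) ∧ ∀ t : ℝ, 0 ≤ t → t ≤ 1 →
      |zt b d (diagonal x + t • H + (t ^ 2 / 2) • W)
        - pwa b d (x + t • μ + (t ^ 2 / 2) • ν)| ≤ C * t ^ 3 := by
  obtain ⟨C1, hC1, h1⟩ := step1 b d hsym x H W hH hW
  have hHd := blk_symm x hH
  have hM := blk_symm x (hW.sub (Wst_symm x hH))
  set Hd := blk x H with hHd_def
  set M := blk x (W - Wst x H) with hM_def
  have hHdb : IsBlk x Hd := fun i j hij => by simp [hHd_def, blk, hij]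
  have hMb : IsBlk x M := fun i j hij => by simp [hM_def, blk, hij]
  obtain ⟨R, hR, hRb, μ, hμ⟩ := block_diag x Hd hHd hHdb
  have hM' := symm_conj hM R
  have hMb' : IsBlk x (Rᵀ * M * R) := (hRb.transpose.mul hMb).mul hRb
  obtain ⟨C2, hC2, h2⟩ := step3 b d hsym x μ (Rᵀ * M * R) hM' hMb'
  have hM'' := blk_symm μ hM'
  set M'' := blk μ (Rᵀ * M * R) with hM''_def
  have hMb'' : IsBlk (fun i => (x i, μ i)) M'' := by
    intro i j hij
    simp only [hM''_def, blk, of_apply]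
    split_ifs with h
    · exact hMb' i j fun h' => hij (Prod.ext h' h)
    · rfl
  obtain ⟨R2, hR2, hR2b, ν, hν⟩ := block_diag _ M'' hM'' hMb''
  refine ⟨C1 + C2, by positivity, μ, ν, ?_, ?_⟩
  · intro hWW
    have hM0 : M = 0 := by
      rw [hM_def, hWW, sub_self]; ext i j; simp [blk]
    have hM0'' : M'' = 0 := by
      rw [hM''_def, hM0]; ext i j; simp [blk]
    rw [hM0''] at hν
    have := congrArg diag hν
    rw [diag_diagonal] at this
    rw [← this]; simp
  · intro t ht0 ht1
    have e1 : zt b d (diagonal x + t • Hd + (t ^ 2 / 2) • M)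
        = zt b d (diagonal x + t • diagonal μ + (t ^ 2 / 2) • (Rᵀ * M * R)) := by
      rw [← zt_conj b d hsym (diagonal x + t • Hd + (t ^ 2 / 2) • M) _ R hR]
      · simp only [mul_add, add_mul, mul_smul_comm, smul_mul_assoc, hμ]
        rw [hRb.conj_diag hR x (fun _ _ h => h)]
      · exact ((isSymm_diagonal x).add (hHd.smul _)).add (hM.smul _)
    have e2 : zt b d (diagonal x + t • diagonal μ + (t ^ 2 / 2) • M'')
        = pwa b d (x + t • μ + (t ^ 2 / 2) • ν) := by
      refine K2 b d hsym _ ?_ R2 hR2 _ ?_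
      · exact ((isSymm_diagonal x).add
          ((isSymm_diagonal μ).smul _)).add (hM''.smul _)
      · simp only [mul_add, add_mul, mul_smul_comm, smul_mul_assoc, hν]
        rw [hR2b.conj_diag hR2 x (fun _ _ h => (Prod.mk.inj h).1),
          hR2b.conj_diag hR2 μ (fun _ _ h => (Prod.mk.inj h).2)]
        rw [← Matrix.diagonal_smul, ← Matrix.diagonal_smul, Matrix.diagonal_add, Matrix.diagonal_add]
        rfl
    have a1 := h1 t ht0 ht1
    have a2 := h2 t ht0 ht1
    rw [e1] at a1
    rw [e2] at a2
    calc _ ≤ _ := abs_sub_le _ _ _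
      _ ≤ C1 * t ^ 3 + C2 * t ^ 3 := add_le_add a1 a2
      _ = _ := by ring

lemma pwa_expand (b : Fin q → Fin n → ℝ) (d : Fin q → ℝ) (x μ ν : Fin n → ℝ) :
    ∃ i, pwa b d x = b i ⬝ᵥ x - d i ∧ ∀ᶠ t in 𝓝[>] (0 : ℝ),
      pwa b d (x + t • μ + (t ^ 2 / 2) • ν)
        = (b i ⬝ᵥ x - d i) + t * (b i ⬝ᵥ μ) + t ^ 2 / 2 * (b i ⬝ᵥ ν) := by
  have : Nonempty (Fin q) := ⟨0⟩
  obtain ⟨i, hi⟩ := Finite.exists_max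
    (fun i => toLex (b i ⬝ᵥ x - d i, toLex (b i ⬝ᵥ μ, b i ⬝ᵥ ν)))
  have hi' : ∀ j, b j ⬝ᵥ x - d j < b i ⬝ᵥ x - d i ∨ (b j ⬝ᵥ x - d j = b i ⬝ᵥ x - d i ∧
      (b j ⬝ᵥ μ < b i ⬝ᵥ μ ∨ (b j ⬝ᵥ μ = b i ⬝ᵥ μ ∧ b j ⬝ᵥ ν ≤ b i ⬝ᵥ ν))) := by
    intro j
    simpa [Prod.Lex.toLex_le_toLex] using hi j
  refine ⟨i, le_antisymm (pwa_le _ _ _ _ fun j => ?_) (le_pwa _ _ _ _), ?_⟩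
  · rcases hi' j with h | h
    · exact h.le
    · exact h.1.le
  have hval : ∀ (j : Fin q) (t : ℝ), b j ⬝ᵥ (x + t • μ + (t ^ 2 / 2) • ν) - d j
      = (b j ⬝ᵥ x - d j) + t * (b j ⬝ᵥ μ) + t ^ 2 / 2 * (b j ⬝ᵥ ν) := by
    intro j t
    simp only [dotProduct_add, dotProduct_smul, smul_eq_mul]; ring
  have hev : ∀ j, ∀ᶠ t in 𝓝[>] (0 : ℝ),
      (b j ⬝ᵥ x - d j) + t * (b j ⬝ᵥ μ) + t ^ 2 / 2 * (b j ⬝ᵥ ν)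
      ≤ (b i ⬝ᵥ x - d i) + t * (b i ⬝ᵥ μ) + t ^ 2 / 2 * (b i ⬝ᵥ ν) := by
    intro j
    rcases hi' j with h | ⟨h1, h | ⟨h2, h3⟩⟩
    · have hc : ContinuousAt (fun t : ℝ =>
          (b j ⬝ᵥ x - d j) + t * (b j ⬝ᵥ μ) + t ^ 2 / 2 * (b j ⬝ᵥ ν)) 0 := by fun_prop
      have hc' : ContinuousAt (fun t : ℝ =>
          (b i ⬝ᵥ x - d i) + t * (b i ⬝ᵥ μ) + t ^ 2 / 2 * (b i ⬝ᵥ ν)) 0 := by fun_prop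
      have := hc.eventually_lt hc' (by simpa using h)
      exact (this.filter_mono nhdsWithin_le_nhds).mono fun t ht => ht.le
    · have hc : ContinuousAt (fun t : ℝ => (b j ⬝ᵥ μ) + t / 2 * (b j ⬝ᵥ ν)) 0 := by fun_prop
      have hc' : ContinuousAt (fun t : ℝ => (b i ⬝ᵥ μ) + t / 2 * (b i ⬝ᵥ ν)) 0 := by fun_prop
      have := hc.eventually_lt hc' (by simpa using h)
      filter_upwards [this.filter_mono nhdsWithin_le_nhds, self_mem_nhdsWithin] with t ht ht0
      have := mul_le_mul_of_nonneg_left ht.le (le_of_lt (show (0 : ℝ) < t from ht0))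
      rw [h1]
      nlinarith
    · filter_upwards with t
      rw [h1, h2]
      have := mul_le_mul_of_nonneg_left h3 (by positivity : 0 ≤ t ^ 2 / 2)
      linarith
  filter_upwards [eventually_all.mpr hev] with t ht
  refine le_antisymm (pwa_le _ _ _ _ fun j => ?_) ?_
  · rw [hval]; exact ht j
  · rw [← hval]; exact le_pwa _ _ _ _

lemma tendsto_of_bound (u : ℝ → ℝ) (c C : ℝ)
    (h : ∀ᶠ t in 𝓝[>] (0 : ℝ), |u t - c| ≤ C * t) : Tendsto u (𝓝[>] 0) (𝓝 c) := by
  rw [tendsto_iff_norm_sub_tendsto_zero]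
  refine squeeze_zero' (Eventually.of_forall fun t => norm_nonneg _) h ?_
  have : ContinuousAt (fun t : ℝ => C * t) 0 := by fun_prop
  have h2 := this.tendsto
  rw [mul_zero] at h2
  exact h2.mono_left nhdsWithin_le_nhds

/-- expansion of the composite function -/
lemma main_expand (b : Fin q → Fin n → ℝ) (d : Fin q → ℝ)
    (hsym : ∀ (σ : Equiv.Perm (Fin n)) (x : Fin n → ℝ), pwa b d (x ∘ σ) = pwa b d x)
    (x : Fin n → ℝ) (H W : Matrix (Fin n) (Fin n) ℝ) (hH : H.IsSymm) (hW : W.IsSymm) :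
    ∃ C : ℝ, 0 ≤ C ∧
      (W = Wst x H → dirDeriv2 (zt b d) (diagonal x) H W = 0) ∧
      ∀ᶠ t in 𝓝[>] (0 : ℝ), |zt b d (diagonal x + t • H + (t ^ 2 / 2) • W)
        - (zt b d (diagonal x) + t * dirDeriv (zt b d) (diagonal x) H
          + t ^ 2 / 2 * dirDeriv2 (zt b d) (diagonal x) H W)| ≤ C * t ^ 3 := by
  obtain ⟨C, hC, μ, ν, hν, h⟩ := propE b d hsym x H W hH hW
  obtain ⟨i, hi, hev⟩ := pwa_expand b d x μ ν
  obtain ⟨L, hL, hlip⟩ := zt_lip b d hsym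
  have hDs : (diagonal x).IsSymm := diagonal_transpose x
  have hzx : zt b d (diagonal x) = pwa b d x :=
    K2 b d hsym _ hDs 1 (by simp) _ (by simp)
  have hpos : ∀ᶠ t in 𝓝[>] (0 : ℝ), 0 < t ∧ t ≤ 1 := by
    filter_upwards [Ioc_mem_nhdsGT (show (0 : ℝ) < 1 by norm_num)] with t ht using ht
  have hF : ∀ᶠ t in 𝓝[>] (0 : ℝ), |zt b d (diagonal x + t • H + (t ^ 2 / 2) • W)
      - (zt b d (diagonal x) + t * (b i ⬝ᵥ μ) + t ^ 2 / 2 * (b i ⬝ᵥ ν))| ≤ C * t ^ 3 := by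
    filter_upwards [hpos, hev] with t ht hte
    have := h t ht.1.le ht.2
    rwa [hte, ← hi, ← hzx] at this
  have hd1 : dirDeriv (zt b d) (diagonal x) H = b i ⬝ᵥ μ := by
    refine Tendsto.limUnder_eq (tendsto_of_bound _ _ (C + |b i ⬝ᵥ ν| + L * N W) ?_)
    filter_upwards [hpos, hF] with t ht hFt
    have h1 := hlip (diagonal x + t • H) (diagonal x + t • H + (t ^ 2 / 2) • W)
      (hDs.add (hH.smul _)) ((hDs.add (hH.smul _)).add (hW.smul _))
    rw [sub_add_cancel_left, N_neg, N_smul, abs_of_nonneg (by positivity : 0 ≤ t ^ 2 / 2)] at h1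
    have ht0 := ht.1
    have e : (zt b d (diagonal x + t • H) - zt b d (diagonal x)) / t - b i ⬝ᵥ μ
        = (zt b d (diagonal x + t • H) - zt b d (diagonal x) - t * (b i ⬝ᵥ μ)) / t := by
      field_simp
    rw [e, abs_div, abs_of_pos ht0, div_le_iff₀ ht0]
    have e2 : zt b d (diagonal x + t • H) - zt b d (diagonal x) - t * (b i ⬝ᵥ μ)
        = (zt b d (diagonal x + t • H) - zt b d (diagonal x + t • H + (t ^ 2 / 2) • W))
          + (zt b d (diagonal x + t • H + (t ^ 2 / 2) • W)
      - (zt b d (diagonal x) + t * (b i ⬝ᵥ μ) + t ^ 2 / 2 * (b i ⬝ᵥ ν)))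
          + t ^ 2 / 2 * (b i ⬝ᵥ ν) := by ring
    rw [e2]
    refine (abs_add_three _ _ _).trans ?_
    rw [abs_mul (t ^ 2 / 2), abs_of_nonneg (by positivity : 0 ≤ t ^ 2 / 2)]
    have h3 : C * t ^ 3 ≤ C * t ^ 2 :=
      mul_le_mul_of_nonneg_left (pow_le_pow_of_le_one ht0.le ht.2 (by norm_num)) hC
    have h4 : 0 ≤ t ^ 2 * |b i ⬝ᵥ ν| := by positivity
    have h5 : 0 ≤ t ^ 2 * (L * N W) := by have := N_nonneg W; positivity
    nlinarith
  have hd2 : dirDeriv2 (zt b d) (diagonal x) H W = b i ⬝ᵥ ν := by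
    refine Tendsto.limUnder_eq (tendsto_of_bound _ _ (2 * C) ?_)
    filter_upwards [hpos, hF] with t ht hFt
    have ht0 := ht.1
    rw [hd1]
    have e : (zt b d (diagonal x + t • H + (t ^ 2 / 2) • W) - zt b d (diagonal x)
        - t * (b i ⬝ᵥ μ)) / (t ^ 2 / 2) - b i ⬝ᵥ ν
        = (zt b d (diagonal x + t • H + (t ^ 2 / 2) • W)
      - (zt b d (diagonal x) + t * (b i ⬝ᵥ μ) + t ^ 2 / 2 * (b i ⬝ᵥ ν))) / (t ^ 2 / 2) := by
      field_simp
      ring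
    rw [e, abs_div, abs_of_pos (by positivity : 0 < t ^ 2 / 2), div_le_iff₀ (by positivity)]
    refine hFt.trans (le_of_eq ?_)
    ring
  refine ⟨C, hC, fun hW => ?_, ?_⟩
  · rw [hd2, hν hW, dotProduct_zero]
  · rw [hd1, hd2]; exact hF

lemma mip_add (Z A B : Matrix (Fin n) (Fin n) ℝ) : mip Z (A + B) = mip Z A + mip Z B := by
  simp [mip, Matrix.mul_add]

lemma mip_sub (Z A B : Matrix (Fin n) (Fin n) ℝ) : mip Z (A - B) = mip Z A - mip Z B := by
  simp [mip, Matrix.mul_sub]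

lemma mip_smul (Z A : Matrix (Fin n) (Fin n) ℝ) (c : ℝ) : mip Z (c • A) = c * mip Z A := by
  simp [mip]

lemma mip_comm (A B : Matrix (Fin n) (Fin n) ℝ) : mip A B = mip B A := by
  rw [mip, mip, ← trace_transpose, transpose_mul, transpose_transpose]

lemma mip_diag (z : Fin n → ℝ) (A : Matrix (Fin n) (Fin n) ℝ) :
    mip (diagonal z) A = ∑ i, z i * A i i := by
  simp [mip, trace, diagonal_mul]

lemma mip_blk {β : Type*} (f : Fin n → β) (z : Fin n → ℝ) (A : Matrix (Fin n) (Fin n) ℝ) :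
    mip (diagonal z) (blk f A) = mip (diagonal z) A := by
  simp [mip_diag, blk]

lemma core_upper (b : Fin q → Fin n → ℝ) (d : Fin q → ℝ)
    (hsym : ∀ (σ : Equiv.Perm (Fin n)) (x : Fin n → ℝ), pwa b d (x ∘ σ) = pwa b d x)
    (x z : Fin n → ℝ) (H W : Matrix (Fin n) (Fin n) ℝ) (hH : H.IsSymm) (hW : W.IsSymm)
    (Xt : Matrix (Fin n) (Fin n) ℝ) (hXt : Xt.IsSymm) (hXt0 : zt b d Xt < 0)
    (hx : zt b d (diagonal x) ≤ 0)
    (hz : ∀ Y : Matrix (Fin n) (Fin n) ℝ, Y.IsSymm → zt b d Y ≤ 0 →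
      mip (diagonal z) (Y - diagonal x) ≤ 0)
    (hd1 : dirDeriv (zt b d) (diagonal x) H ≤ 0) (hzH : mip (diagonal z) H = 0)
    (hd2 : dirDeriv2 (zt b d) (diagonal x) H W ≤ 0) :
    mip (diagonal z) W ≤ mip (diagonal z) (Wst x H) := by
  obtain ⟨C1, hC1, -, h1⟩ := main_expand b d hsym x H W hH hW
  obtain ⟨C2, hC2, h2⟩ := step1 b d hsym x H W hH hW
  have hDs : (diagonal x).IsSymm := isSymm_diagonal x
  have hHd := blk_symm x hH
  have hM := blk_symm x (hW.sub (Wst_symm x hH))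
  have hzM : mip (diagonal z) (blk x (W - Wst x H))
      = mip (diagonal z) W - mip (diagonal z) (Wst x H) := by rw [mip_blk, mip_sub]
  have hzHd : mip (diagonal z) (blk x H) = 0 := by rw [mip_blk, hzH]
  set Hd := blk x H
  set M := blk x (W - Wst x H)
  set m := mip (diagonal z) M with hm
  suffices hm0 : m ≤ 0 by linarith
  set σ := -zt b d Xt with hσ
  have hσ0 : 0 < σ := by linarith
  set C := (C1 + C2) / σ with hC
  have hC0 : 0 ≤ C := by positivity
  set c := mip (diagonal z) (Xt - diagonal x) with hc
  have hev1 : ∀ᶠ t in 𝓝[>] (0 : ℝ), C * t ^ 3 < 1 := by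
    have h1 : ContinuousAt (fun t : ℝ => C * t ^ 3) 0 := by fun_prop
    have h2 : ContinuousAt (fun _ : ℝ => (1 : ℝ)) 0 := by fun_prop
    exact (h1.eventually_lt h2 (by simp)).filter_mono nhdsWithin_le_nhds
  have hpos : ∀ᶠ t in 𝓝[>] (0 : ℝ), 0 < t ∧ t ≤ 1 := by
    filter_upwards [Ioc_mem_nhdsGT (show (0 : ℝ) < 1 by norm_num)] with t ht using ht
  have hfin : ∀ᶠ t in 𝓝[>] (0 : ℝ), (1 - C * t ^ 3) * (m / 2) + C * t * c ≤ 0 := by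
    filter_upwards [hev1, hpos, h1] with t hCt ht h1t
    have ht0 := ht.1
    have h2t := h2 t ht.1.le ht.2
    set Y := diagonal x + t • Hd + (t ^ 2 / 2) • M with hY
    have hYs : Y.IsSymm := (hDs.add (hHd.smul _)).add (hM.smul _)
    have hYz : zt b d Y ≤ (C1 + C2) * t ^ 3 := by
      have a1 := (abs_le.mp h1t).2
      have a2 := (abs_le.mp h2t).1
      have a3 := mul_nonpos_of_nonneg_of_nonpos ht0.le hd1
      have a4 := mul_nonpos_of_nonneg_of_nonpos (by positivity : 0 ≤ t ^ 2 / 2) hd2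
      linarith
    have hs0 : 0 ≤ C * t ^ 3 := by positivity
    have hcv := zt_convex b d hsym Y Xt hYs hXt (C * t ^ 3) hs0 hCt.le
    have hle : zt b d ((1 - C * t ^ 3) • Y + (C * t ^ 3) • Xt) ≤ 0 := by
      refine hcv.trans ?_
      have e1 : C * t ^ 3 * zt b d Xt = - ((C1 + C2) * t ^ 3) := by
        have : zt b d Xt = -σ := by rw [hσ, neg_neg]
        rw [this, hC]; field_simp
      have e2 : (1 - C * t ^ 3) * zt b d Y ≤ (1 - C * t ^ 3) * ((C1 + C2) * t ^ 3) :=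
        mul_le_mul_of_nonneg_left hYz (by linarith)
      have e3 : 0 ≤ C * t ^ 3 * ((C1 + C2) * t ^ 3) := by positivity
      linarith
    have hn := hz _ ((hYs.smul _).add (hXt.smul _)) hle
    have e : (1 - C * t ^ 3) • Y + (C * t ^ 3) • Xt - diagonal x
        = (1 - C * t ^ 3) • (t • Hd + (t ^ 2 / 2) • M) + (C * t ^ 3) • (Xt - diagonal x) := by
      rw [hY]; module
    rw [e, mip_add, mip_smul, mip_smul, mip_add, mip_smul, mip_smul, hzHd, ← hm, ← hc] at hn
    have e5 : (1 - C * t ^ 3) * (t * 0 + t ^ 2 / 2 * m) + C * t ^ 3 * c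
        = t ^ 2 * ((1 - C * t ^ 3) * (m / 2) + C * t * c) := by ring
    rw [e5] at hn
    exact nonpos_of_mul_nonpos_right hn (by positivity)
  have hlim : Tendsto (fun t : ℝ => (1 - C * t ^ 3) * (m / 2) + C * t * c) (𝓝[>] 0)
      (𝓝 (m / 2)) := by
    have : ContinuousAt (fun t : ℝ => (1 - C * t ^ 3) * (m / 2) + C * t * c) 0 := by fun_prop
    have h2 := this.tendsto
    simp only [ne_eq, OfNat.ofNat_ne_zero, not_false_eq_true, zero_pow, mul_zero, sub_zero, one_mul,
      zero_mul, add_zero] at h2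
    exact h2.mono_left nhdsWithin_le_nhds
  have := le_of_tendsto hlim hfin
  linarith

lemma mpInv_eq (A B : Matrix (Fin n) (Fin n) ℝ) (h1 : A * B * A = A) (h2 : B * A * B = B)
    (h3 : (A * B)ᵀ = A * B) (h4 : (B * A)ᵀ = B * A) : mpInv A = B := by
  have hex : ∃ B, A * B * A = A ∧ B * A * B = B ∧ (A * B)ᵀ = A * B ∧ (B * A)ᵀ = B * A :=
    ⟨B, h1, h2, h3, h4⟩
  obtain ⟨k1, k2, k3, k4⟩ := Classical.epsilon_spec hex
  change mpInv A = B
  have k : mpInv A = Classical.epsilon fun B =>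
    A * B * A = A ∧ B * A * B = B ∧ (A * B)ᵀ = A * B ∧ (B * A)ᵀ = B * A := rfl
  rw [← k] at k1 k2 k3 k4
  set P := mpInv A
  have e1 : A * P = A * B := by
    calc A * P = (A * B) * (A * P) := by
          rw [← Matrix.mul_assoc, h1]
      _ = (A * B)ᵀ * (A * P)ᵀ := by rw [h3, k3]
      _ = (A * P * A * B)ᵀ := by rw [← transpose_mul]; simp only [Matrix.mul_assoc]
      _ = A * B := by rw [k1, h3]
  have e2 : P * A = B * A := by
    calc P * A = (P * A) * (B * A) := by
          rw [Matrix.mul_assoc, ← Matrix.mul_assoc A, h1]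
      _ = (P * A)ᵀ * (B * A)ᵀ := by rw [h4, k4]
      _ = (B * (A * P * A))ᵀ := by rw [← transpose_mul]; simp only [Matrix.mul_assoc]
      _ = B * A := by rw [k1, h4]
  calc P = P * A * P := k2.symm
    _ = B * A * P := by rw [e2]
    _ = B * A * B := by rw [Matrix.mul_assoc, e1, Matrix.mul_assoc]
    _ = B := h2

lemma mpInv_diag (V : Matrix (Fin n) (Fin n) ℝ) (hV : Vᵀ * V = 1) (y : Fin n → ℝ) :
    mpInv (V * diagonal y * Vᵀ) = V * diagonal (fun i => (y i)⁻¹) * Vᵀ := by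
  have hm : ∀ A B : Matrix (Fin n) (Fin n) ℝ, (V * A * Vᵀ) * (V * B * Vᵀ) = V * (A * B) * Vᵀ := by
    intro A B
    calc _ = V * A * (Vᵀ * V) * B * Vᵀ := by simp only [Matrix.mul_assoc]
      _ = _ := by rw [hV, Matrix.mul_one]; simp only [Matrix.mul_assoc]
  have ht : ∀ y : Fin n → ℝ, (V * diagonal y * Vᵀ)ᵀ = V * diagonal y * Vᵀ := by
    intro y
    rw [transpose_mul, transpose_mul, transpose_transpose, diagonal_transpose, Matrix.mul_assoc]
  have c1 : ∀ a : ℝ, a * a⁻¹ * a = a := fun a => mul_inv_mul_cancel a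
  have c2 : ∀ a : ℝ, a⁻¹ * a * a⁻¹ = a⁻¹ := fun a => by
    simpa using mul_inv_mul_cancel a⁻¹
  refine mpInv_eq _ _ ?_ ?_ ?_ ?_
  · simp only [hm, diagonal_mul_diagonal, c1]
  · simp only [hm, diagonal_mul_diagonal, c2]
  · simp only [hm, diagonal_mul_diagonal, ht]
  · simp only [hm, diagonal_mul_diagonal, ht]

lemma mip_conj (V A B : Matrix (Fin n) (Fin n) ℝ) :
    mip (V * A * Vᵀ) B = mip A (Vᵀ * B * V) := by
  rw [mip, mip, transpose_mul, transpose_mul, transpose_transpose, Matrix.mul_assoc,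
    Matrix.trace_mul_comm]
  simp only [Matrix.mul_assoc]

lemma Upsilon_eq (X Z V H : Matrix (Fin n) (Fin n) ℝ) (hV : V ∈ OSet X) :
    Upsilon X Z V H = mip (diagonal (lamVec Z)) (Wst (lamVec X) (Vᵀ * H * V)) := by
  obtain ⟨hVV, hX⟩ := hV
  have hVV' : V * Vᵀ = 1 := mul_eq_one_comm.mp hVV
  rw [Upsilon, mip_diag, Finset.mul_sum]
  refine Finset.sum_congr rfl fun i _ => ?_
  have e : X - lamVec X i • (1 : Matrix (Fin n) (Fin n) ℝ)
      = V * diagonal (fun k => lamVec X k - lamVec X i) * Vᵀ := by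
    have : diagonal (fun k => lamVec X k - lamVec X i)
        = diagonal (lamVec X) - lamVec X i • (1 : Matrix (Fin n) (Fin n) ℝ) := by
      ext j k
      by_cases h : j = k
      · subst h; simp
      · simp [h]
    rw [this, Matrix.mul_sub, Matrix.sub_mul, ← hX, Matrix.mul_smul, Matrix.smul_mul,
      Matrix.mul_one, hVV']
  rw [e, mpInv_diag V hVV]
  have e2 : Vᵀ * H * (V * diagonal (fun k => (lamVec X k - lamVec X i)⁻¹) * Vᵀ) * H * V
      = (Vᵀ * H * V) * diagonal (fun k => (lamVec X k - lamVec X i)⁻¹) * (Vᵀ * H * V) := by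
    simp only [Matrix.mul_assoc]
  rw [e2, mul_apply]
  simp only [mul_diagonal, Wst, of_apply, if_true]
  ring

end Sol

/-- Proposition 3.8.  For `H` in the critical cone `C(X̄+Z̄; N_K(X̄))`, the
support function of the second-order tangent set
`T²_K(X̄,H) = {W ∈ Sⁿ : ζ''(X̄;H,W) ≤ 0}` evaluated at `Z̄` equals
`2 ∑_l ⟨Λ(Z̄)_{αˡαˡ}, V̄ᵀ_{αˡ} H (X̄ - v̄ₗ I)† H V̄_{αˡ}⟩`. -/
theorem stmt12 {n q : ℕ} [NeZero q]
    (b : Fin q → Fin n → ℝ) (d : Fin q → ℝ)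
    (hsym : ∀ (σ : Equiv.Perm (Fin n)) (x : Fin n → ℝ), pwa b d (x ∘ σ) = pwa b d x)
    (zeta : Matrix (Fin n) (Fin n) ℝ → ℝ)
    (hzeta : zeta = fun X => pwa b d (lamVec X))
    (K : Set (Matrix (Fin n) (Fin n) ℝ))
    (hK : K = {X | X.IsSymm ∧ zeta X ≤ 0})
    (hSlater : ∃ Xt : Matrix (Fin n) (Fin n) ℝ, Xt.IsSymm ∧ zeta Xt < 0)
    (Xb : Matrix (Fin n) (Fin n) ℝ) (hXbK : Xb ∈ K)
    (Zb : Matrix (Fin n) (Fin n) ℝ) (hZb : Zb ∈ NK K Xb)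
    (Vb : Matrix (Fin n) (Fin n) ℝ) (hVb : Vb ∈ OSet Xb ∩ OSet Zb)
    (H : Matrix (Fin n) (Fin n) ℝ) (hH : H.IsSymm)
    (hcrit : dirDeriv zeta Xb H ≤ 0 ∧ mip Zb H = 0) :
    sSup {t : ℝ | ∃ W : Matrix (Fin n) (Fin n) ℝ, W.IsSymm ∧
        dirDeriv2 zeta Xb H W ≤ 0 ∧ t = mip W Zb} =
      Upsilon Xb Zb Vb H := by
  subst hzeta
  subst hK
  obtain ⟨hVX, hVZ⟩ := hVb
  obtain ⟨Xt, hXt, hXt0⟩ := hSlater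
  obtain ⟨hXs, hX0⟩ := hXbK
  obtain ⟨hZs, hZn⟩ := hZb
  obtain ⟨hc1, hc2⟩ := hcrit
  have hV : Vbᵀ * Vb = 1 := hVX.1
  have hV' : Vb * Vbᵀ = 1 := mul_eq_one_comm.mp hV
  have hUps := Sol.Upsilon_eq Xb Zb Vb H hVX
  set x := lamVec Xb with hx
  set z := lamVec Zb with hz
  have hXe : Vbᵀ * Xb * Vb = Matrix.diagonal x := by
    calc Vbᵀ * Xb * Vb = Vbᵀ * (Vb * Matrix.diagonal x * Vbᵀ) * Vb := by rw [← hVX.2]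
      _ = (Vbᵀ * Vb) * Matrix.diagonal x * (Vbᵀ * Vb) := by simp only [Matrix.mul_assoc]
      _ = _ := by rw [hV]; simp
  have hZe : Zb = Vb * Matrix.diagonal z * Vbᵀ := hVZ.2
  have hback : ∀ Y : Matrix (Fin n) (Fin n) ℝ, Vbᵀ * (Vb * Y * Vbᵀ) * Vb = Y := by
    intro Y
    calc _ = (Vbᵀ * Vb) * Y * (Vbᵀ * Vb) := by simp only [Matrix.mul_assoc]
      _ = _ := by rw [hV]; simp
  have hcs : ∀ Y : Matrix (Fin n) (Fin n) ℝ, Y.IsSymm → (Vb * Y * Vbᵀ).IsSymm := by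
    intro Y hY
    have := Sol.symm_conj hY Vbᵀ
    rwa [transpose_transpose] at this
  set h := Vbᵀ * H * Vb with hh
  have hhs : h.IsSymm := Sol.symm_conj hH Vb
  have hdd : dirDeriv (Sol.zt b d) Xb H = dirDeriv (Sol.zt b d) (Matrix.diagonal x) h := by
    unfold dirDeriv
    congr 1
    funext t
    rw [← Sol.zt_conj b d hsym (Xb + t • H) (hXs.add (hH.smul _)) Vb hV,
      ← Sol.zt_conj b d hsym Xb hXs Vb hV, mul_add, add_mul, hXe, mul_smul_comm, smul_mul_assoc]
  have hdd2 : ∀ W : Matrix (Fin n) (Fin n) ℝ, W.IsSymm → dirDeriv2 (Sol.zt b d) Xb H W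
      = dirDeriv2 (Sol.zt b d) (Matrix.diagonal x) h (Vbᵀ * W * Vb) := by
    intro W hW
    unfold dirDeriv2
    congr 1
    funext t
    rw [hdd, ← Sol.zt_conj b d hsym (Xb + t • H + (t ^ 2 / 2) • W)
      ((hXs.add (hH.smul _)).add (hW.smul _)) Vb hV,
      ← Sol.zt_conj b d hsym Xb hXs Vb hV, mul_add, add_mul, mul_add, add_mul, hXe, mul_smul_comm,
      smul_mul_assoc, mul_smul_comm, smul_mul_assoc]
  have hmip : ∀ W : Matrix (Fin n) (Fin n) ℝ,
      mip Zb W = mip (Matrix.diagonal z) (Vbᵀ * W * Vb) := by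
    intro W
    conv_lhs => rw [hZe]
    exact Sol.mip_conj _ _ _
  have hzx : Sol.zt b d (Matrix.diagonal x) ≤ 0 := by
    rw [← hXe, Sol.zt_conj b d hsym Xb hXs Vb hV]; exact hX0
  refine IsGreatest.csSup_eq ⟨?_, ?_⟩
  · have hWs := hcs _ (Sol.Wst_symm x hhs)
    refine ⟨Vb * Sol.Wst x h * Vbᵀ, hWs, ?_, ?_⟩
    · obtain ⟨C, -, h0, -⟩ := Sol.main_expand b d hsym x h (Sol.Wst x h) hhs (Sol.Wst_symm x hhs)
      have := hdd2 _ hWs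
      rw [hback, h0 rfl] at this
      exact this.le
    · rw [Sol.mip_comm, hmip, hback, hUps]
  · rintro _ ⟨W, hW, hW2, rfl⟩
    rw [Sol.mip_comm, hmip, hUps]
    refine Sol.core_upper b d hsym x z h (Vbᵀ * W * Vb) hhs (Sol.symm_conj hW Vb) Xt hXt hXt0 hzx
      ?_ ?_ ?_ ?_
    · intro Y hY hY0
      have h1 := hZn (Vb * Y * Vbᵀ) ⟨hcs Y hY, by
        have := Sol.zt_conj b d hsym _ (hcs Y hY) Vb hV
        rw [hback] at this
        exact this.symm.le.trans hY0⟩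
      rwa [hmip, mul_sub, sub_mul, hback, hXe] at h1
    · rw [← hdd]; exact hc1
    · rw [← hmip]; exact hc2
    · rw [← hdd2 W hW]; exact hW2

end
end

section
/- Let ζ = ψ∘λ, K = {X ∈ Sⁿ : ζ(X) ≤ 0}, X̄ ∈ K with distinct eigenvalues v̄1 > … > v̄r, Z̄ ∈ N_K(X̄), and V̄ ∈ 𝕆ⁿ(X̄) ∩ 𝕆ⁿ(Z̄). Define Υ²_{X̄}(Z̄,H) := 2 ∑_{l=1}^{r} ⟨ Λ(Z̄)_{α^l α^l}, V̄ᵀ_{α^l} H (X̄ − v̄_l I)† H V̄_{α^l} ⟩. Then for every H ∈ Sⁿ, Υ²_{X̄}(Z̄,H) = −2 ∑_{1≤l<l'≤r} ∑_{i∈α^l} ∑_{j∈α^{l'}} [(λ_i(Z̄) − λ_j(Z̄)) / (λ_i(X̄) − λ_j(X̄))] · ((V̄ᵀ_{α^l} H V̄_{α^{l'}})_{ij})², and consequently Υ²_{X̄}(Z̄,H) ≤ 0 for all H ∈ Sⁿ. -/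
open Matrix Filter Topology Set
open scoped Classical

noncomputable section

theorem mpInv_unique13 {n : ℕ} {A B C : Matrix (Fin n) (Fin n) ℝ}
    (hB : A * B * A = A ∧ B * A * B = B ∧ (A * B)ᵀ = A * B ∧ (B * A)ᵀ = B * A)
    (hC : A * C * A = A ∧ C * A * C = C ∧ (A * C)ᵀ = A * C ∧ (C * A)ᵀ = C * A) : B = C := by
  obtain ⟨b1, b2, b3, b4⟩ := hB
  obtain ⟨c1, c2, c3, c4⟩ := hC
  have h1 : A * B = A * C := by
    calc A * B = (A * C) * (A * B) := by rw [← Matrix.mul_assoc, c1]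
      _ = ((A * B) * (A * C))ᵀ := by rw [Matrix.transpose_mul, b3, c3]
      _ = (A * C)ᵀ := by rw [← Matrix.mul_assoc, b1]
      _ = A * C := c3
  have h2 : B * A = C * A := by
    calc B * A = (B * A) * (C * A) := by rw [Matrix.mul_assoc, ← Matrix.mul_assoc A, c1]
      _ = ((C * A) * (B * A))ᵀ := by rw [Matrix.transpose_mul, b4, c4]
      _ = (C * A)ᵀ := by rw [Matrix.mul_assoc, ← Matrix.mul_assoc A, b1]
      _ = C * A := c4
  calc B = B * A * B := b2.symm
    _ = C * (A * C) := by rw [h2, Matrix.mul_assoc, h1]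
    _ = C := by rw [← Matrix.mul_assoc, c2]

theorem mpInv_diag13 {n : ℕ} (V : Matrix (Fin n) (Fin n) ℝ) (hV : Vᵀ * V = 1) (w : Fin n → ℝ) :
    mpInv (V * diagonal w * Vᵀ) = V * diagonal (fun i => (w i)⁻¹) * Vᵀ := by
  have key : ∀ a b : Fin n → ℝ, (V * diagonal a * Vᵀ) * (V * diagonal b * Vᵀ)
      = V * diagonal (fun i => a i * b i) * Vᵀ := by
    intro a b
    calc _ = V * diagonal a * (Vᵀ * V) * diagonal b * Vᵀ := by simp only [Matrix.mul_assoc]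
      _ = _ := by rw [hV, Matrix.mul_one, Matrix.mul_assoc V, diagonal_mul_diagonal]
  have tr : ∀ a : Fin n → ℝ, (V * diagonal a * Vᵀ)ᵀ = V * diagonal a * Vᵀ := by
    intro a
    simp [Matrix.transpose_mul, Matrix.mul_assoc]
  have hW : (fun B => (V * diagonal w * Vᵀ) * B * (V * diagonal w * Vᵀ) = (V * diagonal w * Vᵀ) ∧
      B * (V * diagonal w * Vᵀ) * B = B ∧ ((V * diagonal w * Vᵀ) * B)ᵀ = (V * diagonal w * Vᵀ) * B ∧
      (B * (V * diagonal w * Vᵀ))ᵀ = B * (V * diagonal w * Vᵀ))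
      (V * diagonal (fun i => (w i)⁻¹) * Vᵀ) := by
    refine ⟨?_, ?_, ?_, ?_⟩
    · rw [key, key]
      simp only [mul_inv_mul_cancel]
    · rw [key, key]
      congr 3
      funext i
      by_cases h : w i = 0 <;> simp [h]
    · rw [key, tr]
    · rw [key, tr]
  exact mpInv_unique13 (Classical.epsilon_spec (p := fun B => (V * diagonal w * Vᵀ) * B * (V * diagonal w * Vᵀ) = (V * diagonal w * Vᵀ) ∧
      B * (V * diagonal w * Vᵀ) * B = B ∧ ((V * diagonal w * Vᵀ) * B)ᵀ = (V * diagonal w * Vᵀ) * B ∧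
      (B * (V * diagonal w * Vᵀ))ᵀ = B * (V * diagonal w * Vᵀ)) ⟨_, hW⟩) hW

theorem lamVec_antitone13 {n : ℕ} (X : Matrix (Fin n) (Fin n) ℝ) : Antitone (lamVec X) := by
  unfold lamVec
  split_ifs with h
  · intro i j hij
    exact Tuple.monotone_sort h.eigenvalues (Fin.rev_le_rev.mpr hij)
  · intro i j hij
    exact le_rfl

/-- Remark 3.2.  For `Z̄ ∈ N_K(X̄)` and `V̄ ∈ 𝕆ⁿ(X̄) ∩ 𝕆ⁿ(Z̄)`, the
sigma-term function satisfies
`Υ²_{X̄}(Z̄,H) = -2 ∑_{λᵢ(X̄) > λⱼ(X̄)} [(λᵢ(Z̄)-λⱼ(Z̄))/(λᵢ(X̄)-λⱼ(X̄))] ((V̄ᵀHV̄)_{ij})²`,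
and hence `Υ²_{X̄}(Z̄,H) ≤ 0`, for every symmetric `H`. -/
theorem stmt13 {n q : ℕ} [NeZero q]
    (b : Fin q → Fin n → ℝ) (d : Fin q → ℝ)
    (hsym : ∀ (σ : Equiv.Perm (Fin n)) (x : Fin n → ℝ), pwa b d (x ∘ σ) = pwa b d x)
    (zeta : Matrix (Fin n) (Fin n) ℝ → ℝ)
    (hzeta : zeta = fun X => pwa b d (lamVec X))
    (K : Set (Matrix (Fin n) (Fin n) ℝ))
    (hK : K = {X | X.IsSymm ∧ zeta X ≤ 0})
    (Xb : Matrix (Fin n) (Fin n) ℝ) (hXbK : Xb ∈ K)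
    (Zb : Matrix (Fin n) (Fin n) ℝ) (hZb : Zb ∈ NK K Xb)
    (Vb : Matrix (Fin n) (Fin n) ℝ) (hVb : Vb ∈ OSet Xb ∩ OSet Zb)
    (H : Matrix (Fin n) (Fin n) ℝ) (hH : H.IsSymm) :
    Upsilon Xb Zb Vb H =
      -2 * ∑ i : Fin n, ∑ j : Fin n,
        (if lamVec Xb j < lamVec Xb i then
          (lamVec Zb i - lamVec Zb j) / (lamVec Xb i - lamVec Xb j) * ((Vbᵀ * H * Vb) i j)^2
        else 0) ∧
    Upsilon Xb Zb Vb H ≤ 0 := by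
  have hanti : ∀ i j, lamVec Xb j < lamVec Xb i → lamVec Zb j ≤ lamVec Zb i := by
    intro i j h
    apply lamVec_antitone13 Zb
    by_contra hc
    exact absurd (lamVec_antitone13 Xb (le_of_not_ge hc)) (not_le.mpr h)
  obtain ⟨⟨hV, hX⟩, -⟩ := hVb
  have hV' : Vb * Vbᵀ = 1 := mul_eq_one_comm.mp hV
  set x := lamVec Xb with hx
  set z := lamVec Zb with hz
  set M := Vbᵀ * H * Vb with hM
  have hMs : ∀ i j, M j i = M i j := by
    intro i j
    have : Mᵀ = M := by
      rw [hM]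
      simp [Matrix.transpose_mul, Matrix.mul_assoc, hH.eq]
    exact congrFun (congrFun this i) j
  have hterm : ∀ i, (Vbᵀ * H * mpInv (Xb - x i • (1 : Matrix (Fin n) (Fin n) ℝ)) * H * Vb) i i
      = ∑ j, (x j - x i)⁻¹ * (M i j) ^ 2 := by
    intro i
    have e1 : Xb - x i • (1 : Matrix (Fin n) (Fin n) ℝ)
        = Vb * diagonal (fun j => x j - x i) * Vbᵀ := by
      have : diagonal (fun j => x j - x i) = diagonal x - x i • (1 : Matrix (Fin n) (Fin n) ℝ) := by
        rw [Matrix.smul_one_eq_diagonal, diagonal_sub]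
      rw [this, Matrix.mul_sub, Matrix.sub_mul, ← hX]
      simp [hV']
    rw [e1, mpInv_diag13 Vb hV]
    have e2 : Vbᵀ * H * (Vb * diagonal (fun j => (x j - x i)⁻¹) * Vbᵀ) * H * Vb
        = M * diagonal (fun j => (x j - x i)⁻¹) * M := by
      simp only [hM, Matrix.mul_assoc]
    rw [e2, Matrix.mul_apply]
    refine Finset.sum_congr rfl fun j _ => ?_
    rw [Matrix.mul_diagonal, hMs i j]
    ring
  have hmain : Upsilon Xb Zb Vb H =
      -2 * ∑ i : Fin n, ∑ j : Fin n,
        (if x j < x i then (z i - z j) / (x i - x j) * (M i j)^2 else 0) := by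
    have e0 : Upsilon Xb Zb Vb H = 2 * ∑ i, ∑ j, z i * ((x j - x i)⁻¹ * (M i j) ^ 2) := by
      unfold Upsilon
      simp only [← hx, ← hz, hterm, Finset.mul_sum]
    have e1 : ∑ i, ∑ j, z i * ((x j - x i)⁻¹ * (M i j) ^ 2)
        = (∑ i, ∑ j, if x j < x i then z i * ((x j - x i)⁻¹ * (M i j) ^ 2) else 0)
        + ∑ i, ∑ j, if x i < x j then z i * ((x j - x i)⁻¹ * (M i j) ^ 2) else 0 := by
      rw [← Finset.sum_add_distrib]
      refine Finset.sum_congr rfl fun i _ => ?_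
      rw [← Finset.sum_add_distrib]
      refine Finset.sum_congr rfl fun j _ => ?_
      rcases lt_trichotomy (x i) (x j) with h | h | h
      · simp [h, h.not_gt]
      · simp [h]
      · simp [h, h.not_gt]
    have e2 : (∑ i, ∑ j, if x i < x j then z i * ((x j - x i)⁻¹ * (M i j) ^ 2) else 0)
        = ∑ i, ∑ j, if x j < x i then z j * ((x i - x j)⁻¹ * (M i j) ^ 2) else 0 := by
      rw [Finset.sum_comm]
      refine Finset.sum_congr rfl fun i _ => Finset.sum_congr rfl fun j _ => ?_
      rw [hMs i j]
    have e3 : ∑ i, ∑ j, z i * ((x j - x i)⁻¹ * (M i j) ^ 2)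
        = - ∑ i, ∑ j, (if x j < x i then (z i - z j) / (x i - x j) * (M i j)^2 else 0) := by
      rw [e1, e2, ← Finset.sum_add_distrib, ← Finset.sum_neg_distrib]
      refine Finset.sum_congr rfl fun i _ => ?_
      rw [← Finset.sum_add_distrib, ← Finset.sum_neg_distrib]
      refine Finset.sum_congr rfl fun j _ => ?_
      split_ifs with h
      · rw [← neg_sub (x i) (x j), inv_neg]
        ring
      · simp
    rw [e0, e3]
    ring
  refine ⟨hmain, ?_⟩
  rw [hmain]
  have hnn : 0 ≤ ∑ i : Fin n, ∑ j : Fin n,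
        (if x j < x i then (z i - z j) / (x i - x j) * (M i j)^2 else 0) := by
    refine Finset.sum_nonneg fun i _ => Finset.sum_nonneg fun j _ => ?_
    split_ifs with h
    · exact mul_nonneg (div_nonneg (sub_nonneg.mpr (hanti i j h)) (sub_nonneg.mpr h.le)) (sq_nonneg _)
    · exact le_rfl
  linarith

end
end
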